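/- arXiv:1001.0094 — 2 statements merged into one kernel-verified Lean document; each statement's English description precedes it below -/
import Mathlib

section
/- Let (X,d_X) be a Polish space and (Ω,F,P) a probability space. For probability kernels μ, ν from Ω to X satisfying E ∫_X d_X(x,x_0) μ_ω(dx) < ∞ and E ∫_X d_X(x,x_0) ν_ω(dx) < ∞ for some x_0 ∈ X, the following Kantorovich–Rubinstein duality holds: W_1(μ,ν) := inf_{π ∈ K(μ,ν)} E ∫_{X×X} d_X(x,y) π_ω(dx,dy) = sup E( ∫_X ψ(ω,x) ν_ω(dx) − ∫_X ψ(ω,x) μ_ω(dx) ), where the supremum is taken over all bounded jointly measurable functions ψ : Ω×X → ℝ such that for each ω the map x ↦ ψ(ω,x) is Lipschitz with Lipschitz constant at most 1. -/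
open MeasureTheory ProbabilityTheory Filter ENNReal

lemma kkr_dual {ι : Type*} [Fintype ι] [PseudoMetricSpace ι] [DecidableEq ι]
    (p q : ι → ℝ) (hp : ∀ i, 0 ≤ p i) (hq : ∀ i, 0 ≤ q i)
    (hp1 : ∑ i, p i = 1) (hq1 : ∑ i, q i = 1) (c : ℝ)
    (hc : ∀ γ : ι → ι → ℝ, (∀ i j, 0 ≤ γ i j) → (∀ i, ∑ j, γ i j = p i) →
      (∀ j, ∑ i, γ i j = q j) → c < ∑ i, ∑ j, γ i j * dist i j) :
    ∃ f : ι → ℝ, LipschitzWith 1 f ∧ c < ∑ i, f i * (q i - p i) := by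
  classical
  have hne : Nonempty ι := by
    by_contra h
    rw [not_nonempty_iff] at h
    simp at hp1
  let A : (ι × ι → ℝ) →ₗ[ℝ] (ι → ℝ) × (ι → ℝ) × ℝ :=
    { toFun := fun g => (fun i => ∑ j, g (i, j), fun j => ∑ i, g (i, j),
        ∑ i, ∑ j, g (i, j) * dist i j)
      map_add' := by
        intro g h
        ext <;> simp [Finset.sum_add_distrib, add_mul]
      map_smul' := by
        intro r g
        ext <;> simp [Finset.mul_sum, mul_assoc] }
  have hA : Continuous A := A.continuous_of_finiteDimensional
  have hK1 : IsCompact (A '' stdSimplex ℝ (ι × ι)) := (isCompact_stdSimplex ℝ (ι × ι)).image hA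
  have hK2 : Convex ℝ (A '' stdSimplex ℝ (ι × ι)) := (convex_stdSimplex ℝ (ι × ι)).linear_image A
  have hB1 : Convex ℝ (({p} : Set (ι → ℝ)) ×ˢ (({q} : Set (ι → ℝ)) ×ˢ Set.Iic c)) :=
    (convex_singleton p).prod ((convex_singleton q).prod (convex_Iic c))
  have hB2 : IsClosed (({p} : Set (ι → ℝ)) ×ˢ (({q} : Set (ι → ℝ)) ×ˢ Set.Iic c)) :=
    isClosed_singleton.prod (isClosed_singleton.prod isClosed_Iic)
  have hdisj : Disjoint (A '' stdSimplex ℝ (ι × ι))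
      (({p} : Set (ι → ℝ)) ×ˢ (({q} : Set (ι → ℝ)) ×ˢ Set.Iic c)) := by
    rw [Set.disjoint_left]
    rintro _ ⟨g, hg, rfl⟩ h
    simp only [Set.mem_prod, Set.mem_singleton_iff, Set.mem_Iic] at h
    obtain ⟨h1, h2, h3⟩ := h
    have := hc (fun i j => g (i, j)) (fun i j => hg.1 _) (fun i => congrFun h1 i)
      (fun j => congrFun h2 j)
    exact absurd h3 (not_le.2 this)
  obtain ⟨Λ, a, b, h1, hab, h2⟩ := geometric_hahn_banach_compact_closed hK2 hK1 hB1 hB2 hdisj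
  set u : ι → ℝ := fun i => Λ (Pi.single i 1, 0, 0) with hu
  set v : ι → ℝ := fun i => Λ (0, Pi.single i 1, 0) with hv
  set t : ℝ := Λ (0, 0, 1) with ht
  have hΛ : ∀ (x y : ι → ℝ) (z : ℝ), Λ (x, y, z) = ∑ i, x i * u i + ∑ i, y i * v i + z * t := by
    intro x y z
    have e1 : (x, y, z) = (∑ i, x i • ((Pi.single i 1, 0, 0) : (ι → ℝ) × (ι → ℝ) × ℝ)) +
        (∑ i, y i • ((0, Pi.single i 1, 0) : (ι → ℝ) × (ι → ℝ) × ℝ)) +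
        z • ((0, 0, 1) : (ι → ℝ) × (ι → ℝ) × ℝ) := by
      ext <;> simp [Prod.fst_sum, Prod.snd_sum, Finset.sum_apply, Pi.single_apply]
    rw [e1]
    simp only [map_add, map_sum, map_smul, smul_eq_mul, hu, hv, ht]
  have h2' := h2 (p, q, c) (by simp)
  rw [hΛ] at h2'
  have hprod := h1 _ ⟨fun x => p x.1 * q x.2, ⟨fun x => mul_nonneg (hp _) (hq _), by
    rw [Fintype.sum_prod_type]; simp [← Finset.mul_sum, hp1, hq1]⟩, rfl⟩
  have hcp := hc (fun i j => p i * q j) (fun i j => mul_nonneg (hp _) (hq _))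
    (fun i => by simp [← Finset.mul_sum, hq1]) (fun i => by simp [← Finset.sum_mul, hp1])
  have e2 : A (fun x => p x.1 * q x.2) = (p, q, ∑ i, ∑ j, p i * q j * dist i j) := by
    ext <;> simp [A, ← Finset.mul_sum, ← Finset.sum_mul, hp1, hq1]
  rw [e2, hΛ] at hprod
  have htneg : t < 0 := by
    by_contra h
    push Not at h
    nlinarith [mul_le_mul_of_nonneg_right hcp.le h]
  have huv : ∀ i j, u i + v j + dist i j * t < a := by
    intro i j
    have := h1 _ ⟨Pi.single (i, j) 1, single_mem_stdSimplex ℝ (i, j), rfl⟩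
    have e3 : A (Pi.single (i, j) 1) = (Pi.single i 1, Pi.single j 1, dist i j) := by
      ext k
      · simp only [A, LinearMap.coe_mk, AddHom.coe_mk, Pi.single_apply, Prod.mk.injEq]
        by_cases hk : k = i <;> simp [hk]
      · simp only [A, LinearMap.coe_mk, AddHom.coe_mk, Pi.single_apply, Prod.mk.injEq]
        by_cases hk : k = j <;> simp [hk]
      · simp only [A, LinearMap.coe_mk, AddHom.coe_mk, Pi.single_apply, Prod.mk.injEq]
        rw [Finset.sum_eq_single i, Finset.sum_eq_single j] <;> simp +contextual
    rw [e3, hΛ] at this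
    simpa [Pi.single_apply] using this
  clear_value u v t
  obtain ⟨s, hs, rfl⟩ : ∃ s, 0 < s ∧ t = -s := ⟨-t, by linarith, by simp⟩

  set f : ι → ℝ := fun j => Finset.univ.inf' Finset.univ_nonempty
    (fun i => dist i j - (u i - a) / s) with hf
  have hfle : ∀ i j, f j ≤ dist i j - (u i - a) / s := fun i j =>
    Finset.inf'_le (f := fun i => dist i j - (u i - a) / s) (Finset.mem_univ i)
  have hlef : ∀ j, ∃ i, f j = dist i j - (u i - a) / s := fun j => by
    obtain ⟨i, -, hi⟩ := Finset.exists_mem_eq_inf' Finset.univ_nonempty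
      (fun i => dist i j - (u i - a) / s)
    exact ⟨i, hi⟩
  refine ⟨f, LipschitzWith.of_le_add fun x y => ?_, ?_⟩
  · obtain ⟨i, hi⟩ := hlef y
    rw [hi]
    have := hfle i x
    have := dist_triangle i y x
    rw [dist_comm y x] at this
    linarith
  · have hfv : ∀ j, v j ≤ s * f j := by
      intro j
      obtain ⟨i, hi⟩ := hlef j
      rw [hi]
      have := huv i j
      have e : s * (dist i j - (u i - a) / s) = s * dist i j - (u i - a) := by field_simp
      rw [e]; linarith
    have hfu : ∀ i, u i - a ≤ - (s * f i) := by
      intro i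
      have := hfle i i
      rw [dist_self, zero_sub] at this
      have := mul_le_mul_of_nonneg_left this hs.le
      have e : s * -((u i - a) / s) = -(u i - a) := by field_simp
      linarith
    have k1 : ∑ i, q i * v i ≤ ∑ i, q i * (s * f i) :=
      Finset.sum_le_sum fun i _ => mul_le_mul_of_nonneg_left (hfv i) (hq i)
    have k2 : ∑ i, p i * (u i - a) ≤ ∑ i, p i * (- (s * f i)) :=
      Finset.sum_le_sum fun i _ => mul_le_mul_of_nonneg_left (hfu i) (hp i)
    have k3 : ∑ i, p i * (u i - a) = ∑ i, p i * u i - a := by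
      simp [mul_sub, Finset.sum_sub_distrib, ← Finset.sum_mul, hp1]
    have k4 : s * ∑ i, f i * (q i - p i) = ∑ i, q i * (s * f i) + ∑ i, p i * (- (s * f i)) := by
      rw [Finset.mul_sum, ← Finset.sum_add_distrib]
      exact Finset.sum_congr rfl fun i _ => by ring
    have : s * c < s * ∑ i, f i * (q i - p i) := by linarith
    exact lt_of_mul_lt_mul_left this hs.le

lemma kkr_dual2 {ι : Type*} [Fintype ι] [PseudoMetricSpace ι]
    (p q : ι → ℝ) (hp : ∀ i, 0 ≤ p i) (hq : ∀ i, 0 ≤ q i)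
    (hp1 : ∑ i, p i = 1) (hq1 : ∑ i, q i = 1) (D : ℝ) (hD : ∀ i j : ι, dist i j ≤ D)
    (δ : ℝ) (hδ : 0 < δ) :
    ∃ γ : ι → ι → ℝ, ∃ f : ι → ℝ, (∀ i j, 0 ≤ γ i j) ∧ (∀ i, ∑ j, γ i j = p i) ∧
      (∀ j, ∑ i, γ i j = q j) ∧ LipschitzWith 1 f ∧ (∀ i, |f i| ≤ D) ∧
      ∑ i, ∑ j, γ i j * dist i j < ∑ i, f i * (q i - p i) + δ := by
  classical
  set S : Set ℝ := {c | ∃ γ : ι → ι → ℝ, (∀ i j, 0 ≤ γ i j) ∧ (∀ i, ∑ j, γ i j = p i) ∧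
      (∀ j, ∑ i, γ i j = q j) ∧ ∑ i, ∑ j, γ i j * dist i j = c} with hS
  have hSne : S.Nonempty := ⟨_, fun i j => p i * q j, fun i j => mul_nonneg (hp _) (hq _),
    fun i => by simp [← Finset.mul_sum, hq1], fun i => by simp [← Finset.sum_mul, hp1], rfl⟩
  have hSb : BddBelow S := by
    refine ⟨0, ?_⟩
    rintro _ ⟨γ, h, -, -, rfl⟩
    exact Finset.sum_nonneg fun i _ => Finset.sum_nonneg fun j _ => mul_nonneg (h _ _) dist_nonneg
  obtain ⟨_, ⟨γ, h1, h2, h3, rfl⟩, hlt⟩ := Real.lt_sInf_add_pos hSne (half_pos hδ)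
  obtain ⟨f, hf, hfc⟩ := kkr_dual p q hp hq hp1 hq1 (sInf S - δ / 2) (by
    intro γ a b c
    have := csInf_le hSb (show _ ∈ S from ⟨γ, a, b, c, rfl⟩)
    linarith)
  have hne : Nonempty ι := by
    by_contra h
    rw [not_nonempty_iff] at h
    simp at hp1
  obtain ⟨i0⟩ := hne
  refine ⟨γ, fun i => f i - f i0, h1, h2, h3, ?_, ?_, ?_⟩
  · refine LipschitzWith.of_le_add fun x y => ?_
    have := hf.le_add_mul x y
    simp at this
    linarith
  · intro i
    have := hf.dist_le_mul i i0
    simp [Real.dist_eq] at this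
    exact this.trans (hD _ _)
  · have : ∑ i, (f i - f i0) * (q i - p i) = ∑ i, f i * (q i - p i) := by
      simp [sub_mul, Finset.sum_sub_distrib, ← Finset.mul_sum, hp1, hq1]
    rw [this]
    linarith

lemma kkr_complete {ι : Type*} [Fintype ι] [PseudoMetricSpace ι]
    (p q : ι → ℝ) (hp1 : ∑ i, p i = 1) (hq1 : ∑ i, q i = 1)
    (D : ℝ) (hD : ∀ i j : ι, dist i j ≤ D)
    (g : ι → ι → ℝ) (hg : ∀ i j, 0 ≤ g i j) (hr : ∀ i, ∑ j, g i j ≤ p i)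
    (hs : ∀ j, ∑ i, g i j ≤ q j) (γ : ι → ι → ℝ)
    (hγ : ∀ i j, γ i j = g i j + (p i - ∑ j, g i j) * (q j - ∑ i, g i j) /
      (1 - ∑ i, ∑ j, g i j)) :
    (∀ i j, 0 ≤ γ i j) ∧ (∀ i, ∑ j, γ i j = p i) ∧ (∀ j, ∑ i, γ i j = q j) ∧
    ∑ i, ∑ j, γ i j * dist i j ≤ ∑ i, ∑ j, g i j * dist i j + D * (1 - ∑ i, ∑ j, g i j) := by
  obtain rfl : γ = _ := funext fun i => funext fun j => hγ i j
  set ρ := 1 - ∑ i, ∑ j, g i j with hρ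
  have e1 : ∑ i, (p i - ∑ j, g i j) = ρ := by rw [Finset.sum_sub_distrib, hp1]
  have e2 : ∑ j, (q j - ∑ i, g i j) = ρ := by
    rw [Finset.sum_sub_distrib, hq1, Finset.sum_comm]
  have n1 : ∀ i, 0 ≤ p i - ∑ j, g i j := fun i => sub_nonneg.2 (hr i)
  have n2 : ∀ i, 0 ≤ q i - ∑ j, g j i := fun i => sub_nonneg.2 (hs i)
  have hρ0 : 0 ≤ ρ := by rw [← e1]; exact Finset.sum_nonneg fun i _ => n1 i
  have z1 : ∀ i, (p i - ∑ j, g i j) * ρ / ρ = p i - ∑ j, g i j := by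
    intro i
    rcases eq_or_ne ρ 0 with h | h
    · have := (Finset.sum_eq_zero_iff_of_nonneg (fun i _ => n1 i)).1 (e1.trans h) i
        (Finset.mem_univ i)
      simp [this]
    · field_simp
  have z2 : ∀ i, ρ * (q i - ∑ j, g j i) / ρ = q i - ∑ j, g j i := by
    intro i
    rcases eq_or_ne ρ 0 with h | h
    · have := (Finset.sum_eq_zero_iff_of_nonneg (fun i _ => n2 i)).1 (e2.trans h) i
        (Finset.mem_univ i)
      simp [this]
    · field_simp
  have n3 : ∀ i j, 0 ≤ (p i - ∑ j, g i j) * (q j - ∑ i, g i j) / ρ :=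
    fun i j => div_nonneg (mul_nonneg (n1 i) (n2 j)) hρ0
  refine ⟨fun i j => add_nonneg (hg i j) (n3 i j), fun i => ?_, fun j => ?_, ?_⟩
  · rw [Finset.sum_add_distrib, ← Finset.sum_div, ← Finset.mul_sum, e2, z1]; ring
  · rw [Finset.sum_add_distrib, ← Finset.sum_div, ← Finset.sum_mul, e1, z2]; ring
  · have : D * ρ = ∑ i, ∑ j, (p i - ∑ j, g i j) * (q j - ∑ i, g i j) / ρ * D := by
      have k : ∀ i, ∑ j, (p i - ∑ j, g i j) * (q j - ∑ i, g i j) / ρ = p i - ∑ j, g i j := by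
        intro i
        rw [← Finset.sum_div, ← Finset.mul_sum, e2, z1]
      simp_rw [← Finset.sum_mul]
      rw [Finset.sum_congr rfl fun i _ => k i, e1, mul_comm]
    rw [this, ← Finset.sum_add_distrib]
    refine Finset.sum_le_sum fun i _ => ?_
    rw [← Finset.sum_add_distrib]
    refine Finset.sum_le_sum fun j _ => ?_
    rw [add_mul]
    have := mul_le_mul_of_nonneg_left (hD i j) (n3 i j)
    linarith

lemma kkr_sel {Ω ι : Type*} [MeasurableSpace Ω] [Fintype ι] [PseudoMetricSpace ι]
    (p q : Ω → ι → ℝ) (mp : ∀ i, Measurable fun ω => p ω i) (mq : ∀ i, Measurable fun ω => q ω i)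
    (hp : ∀ ω i, 0 ≤ p ω i) (hq : ∀ ω i, 0 ≤ q ω i)
    (hp1 : ∀ ω, ∑ i, p ω i = 1) (hq1 : ∀ ω, ∑ i, q ω i = 1)
    (D : ℝ) (hD0 : 0 ≤ D) (hD : ∀ i j : ι, dist i j ≤ D) (δ : ℝ) (hδ : 0 < δ) :
    ∃ (γ : Ω → ι → ι → ℝ) (F : ℕ → ι → ℝ) (n : Ω → ℕ),
      (∀ i j, Measurable fun ω => γ ω i j) ∧ Measurable n ∧
      (∀ k, LipschitzWith 1 (F k) ∧ ∀ i, |F k i| ≤ D) ∧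
      ∀ ω, (∀ i j, 0 ≤ γ ω i j) ∧ (∀ i, ∑ j, γ ω i j = p ω i) ∧ (∀ j, ∑ i, γ ω i j = q ω j) ∧
        ∑ i, ∑ j, γ ω i j * dist i j ≤ ∑ i, F (n ω) i * (q ω i - p ω i) + δ := by
  classical
  let L : Set (ι → ℝ) := {f | LipschitzWith 1 f ∧ ∀ i, |f i| ≤ D}
  have hLne : Nonempty L := ⟨⟨fun _ => 0, LipschitzWith.const' 0, fun _ => by simpa using hD0⟩⟩
  let F0 : ℕ → L := TopologicalSpace.denseSeq L
  have hF0 : DenseRange F0 := TopologicalSpace.denseRange_denseSeq L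
  obtain ⟨e, he⟩ := exists_surjective_nat ((ι → ι → ℕ) × ℕ)
  set η : ℝ := δ / (2 * (D + 1)) with hη
  have hη0 : 0 < η := by positivity
  have hDη : D * η ≤ δ / 2 := by
    rw [hη, mul_div_assoc', div_le_div_iff₀ (by positivity) (by positivity)]
    nlinarith
  obtain ⟨N, hN⟩ := exists_nat_gt (((Fintype.card ι : ℝ) * Fintype.card ι) / η)
  have hN0 : (0 : ℝ) < N := lt_of_le_of_lt (by positivity) hN
  let g : ℕ → ι → ι → ℝ := fun k i j => ((e k).1 i j : ℝ) / N
  let F : ℕ → ι → ℝ := fun k => (F0 (e k).2 : ι → ℝ)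
  let S : Ω → ℕ → Prop := fun ω k => (∀ i, ∑ j, g k i j ≤ p ω i) ∧ (∀ j, ∑ i, g k i j ≤ q ω j) ∧
    1 - η ≤ ∑ i, ∑ j, g k i j ∧
    ∑ i, ∑ j, g k i j * dist i j ≤ ∑ i, F k i * (q ω i - p ω i) + δ / 2
  have hSm : ∀ k, MeasurableSet {ω | S ω k} := by
    intro k
    have m1 : MeasurableSet {ω | ∀ i, ∑ j, g k i j ≤ p ω i} := by
      rw [Set.ofPred_forall]
      exact MeasurableSet.iInter fun i => measurableSet_le measurable_const (mp i)
    have m2 : MeasurableSet {ω | ∀ j, ∑ i, g k i j ≤ q ω j} := by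
      rw [Set.ofPred_forall]
      exact MeasurableSet.iInter fun i => measurableSet_le measurable_const (mq i)
    have m3 : MeasurableSet {ω | ∑ i, ∑ j, g k i j * dist i j ≤
        ∑ i, F k i * (q ω i - p ω i) + δ / 2} := by
      refine measurableSet_le measurable_const ?_
      refine Measurable.add_const (Finset.measurable_fun_sum _ fun i _ => ?_) _
      exact ((mq i).sub (mp i)).const_mul _
    exact m1.inter (m2.inter ((MeasurableSet.const _).inter m3))
  have hSe : ∀ ω, ∃ k, S ω k := by
    intro ω
    obtain ⟨γ, f, h1, h2, h3, h4, h5, h6⟩ := kkr_dual2 (p ω) (q ω) (hp ω) (hq ω) (hp1 ω) (hq1 ω)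
      D hD (δ / 2) (by positivity)
    have hopen : IsOpen {f : L | ∑ i, ∑ j, γ i j * dist i j <
        ∑ i, (f : ι → ℝ) i * (q ω i - p ω i) + δ / 2} := by
      refine isOpen_lt continuous_const ?_
      refine Continuous.add (continuous_finsetSum _ fun i _ => Continuous.mul ?_ continuous_const)
        continuous_const
      exact (continuous_apply i).comp continuous_subtype_val
    obtain ⟨m, hm⟩ := hF0.exists_mem_open hopen ⟨⟨f, h4, h5⟩, h6⟩
    obtain ⟨k, hk⟩ := he (fun i j => ⌊γ i j * N⌋₊, m)
    have gle : ∀ i j, g k i j ≤ γ i j := by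
      intro i j
      simp only [g, hk]
      rw [div_le_iff₀ hN0]
      exact Nat.floor_le (mul_nonneg (h1 i j) hN0.le)
    have leg : ∀ i j, γ i j - 1 / N ≤ g k i j := by
      intro i j
      simp only [g, hk]
      rw [sub_le_iff_le_add, ← add_div, le_div_iff₀ hN0]
      exact (Nat.lt_floor_add_one _).le
    refine ⟨k, fun i => ?_, fun j => ?_, ?_, ?_⟩
    · rw [← h2]; exact Finset.sum_le_sum fun j _ => gle i j
    · rw [← h3]; exact Finset.sum_le_sum fun i _ => gle i j
    · have : ∑ i, ∑ j, (γ i j - 1 / N) ≤ ∑ i, ∑ j, g k i j :=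
        Finset.sum_le_sum fun i _ => Finset.sum_le_sum fun j _ => leg i j
      simp only [Finset.sum_sub_distrib, h2, hp1] at this
      refine le_trans ?_ this
      simp only [Finset.sum_const, Finset.card_univ, nsmul_eq_mul]
      have h7 : (Fintype.card ι : ℝ) * (Fintype.card ι * (1 / N)) ≤ η := by
        rw [div_lt_iff₀ hη0] at hN
        rw [← mul_assoc, mul_one_div, div_le_iff₀ hN0]
        linarith
      linarith
    · have : F k = F0 m := by simp only [F, hk]
      rw [this]
      refine le_trans ?_ (le_of_lt hm)
      exact Finset.sum_le_sum fun i _ => Finset.sum_le_sum fun j _ =>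
        mul_le_mul_of_nonneg_right (gle i j) dist_nonneg
  let n : Ω → ℕ := fun ω => Nat.find (hSe ω)
  have hn : Measurable n := measurable_find hSe hSm
  have mg : ∀ i j, Measurable fun ω => g (n ω) i j := fun i j =>
    (measurable_from_nat (f := fun k => g k i j)).comp hn
  refine ⟨fun ω i j => g (n ω) i j + (p ω i - ∑ j, g (n ω) i j) * (q ω j - ∑ i, g (n ω) i j) /
      (1 - ∑ i, ∑ j, g (n ω) i j), F, n, ?_, hn, fun k => (F0 (e k).2).2, fun ω => ?_⟩
  · intro i j
    fun_prop
  · obtain ⟨s1, s2, s3, s4⟩ := Nat.find_spec (hSe ω)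
    obtain ⟨t1, t2, t3, t4⟩ := kkr_complete (p ω) (q ω) (hp1 ω) (hq1 ω) D hD (g (n ω))
      (fun i j => by positivity) s1 s2 _ (fun i j => rfl)
    refine ⟨t1, t2, t3, t4.trans ?_⟩
    have : D * (1 - ∑ i, ∑ j, g (n ω) i j) ≤ D * η :=
      mul_le_mul_of_nonneg_left (by change 1 - η ≤ ∑ i, ∑ j, g (n ω) i j at s3; linarith) hD0
    change ∑ i, ∑ j, g (n ω) i j * dist i j ≤ ∑ i, F (n ω) i * (q ω i - p ω i) + δ / 2 at s4
    linarith

lemma kkr_lint {X ι : Type*} [MeasurableSpace X] [Fintype ι] [MeasurableSpace ι]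
    [MeasurableSingletonClass ι] (T : X → ι) (hT : Measurable T) (ν : Measure X)
    (φ : ι → ℝ≥0∞) : ∫⁻ y, φ (T y) ∂ν = ∑ j, φ j * ν (T ⁻¹' {j}) := by
  rw [← lintegral_map (f := φ) (measurable_of_finite φ) hT, lintegral_fintype]
  refine Finset.sum_congr rfl fun j _ => ?_
  rw [Measure.map_apply hT (measurableSet_singleton j)]

lemma kkr_marg {X ι : Type*} [MeasurableSpace X] [Fintype ι] [MeasurableSpace ι]
    [MeasurableSingletonClass ι] (T : X → ι) (hT : Measurable T) (μ ν : Measure X)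
    [IsFiniteMeasure μ] [IsFiniteMeasure ν]
    (G c : ι → ι → ℝ≥0∞) (h1 : ∀ i, ∑ j, G i j = μ (T ⁻¹' {i})) (h2 : ∀ i j, G i j ≤ ν (T ⁻¹' {j}))
    (hc : ∀ i j, c i j = G i j / (μ (T ⁻¹' {i}) * ν (T ⁻¹' {j}))) :
    ∀ᵐ x ∂μ, ∫⁻ y, c (T x) (T y) ∂ν = 1 := by
  have hae : ∀ᵐ i ∂(μ.map T), μ (T ⁻¹' {i}) ≠ 0 := by
    rw [ae_iff_of_countable]
    intro i hi
    rwa [Measure.map_apply hT (measurableSet_singleton i)] at hi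
  filter_upwards [ae_of_ae_map hT.aemeasurable hae] with x hx
  rw [kkr_lint T hT ν]
  have : ∀ j, c (T x) j * ν (T ⁻¹' {j}) = G (T x) j / μ (T ⁻¹' {T x}) := by
    intro j
    rw [hc]
    by_cases h : ν (T ⁻¹' {j}) = 0
    · have := h2 (T x) j
      rw [h] at this
      simp [h, le_antisymm this bot_le]
    · rw [ENNReal.div_eq_inv_mul, ENNReal.mul_inv (Or.inl hx) (Or.inl (measure_ne_top _ _)),
        ENNReal.div_eq_inv_mul]
      calc _ = (μ (T ⁻¹' {T x}))⁻¹ * G (T x) j * ((ν (T ⁻¹' {j}))⁻¹ * ν (T ⁻¹' {j})) := by ring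
        _ = _ := by rw [ENNReal.inv_mul_cancel h (measure_ne_top _ _), mul_one]
  simp_rw [this, ENNReal.div_eq_inv_mul, ← Finset.mul_sum, h1]
  exact ENNReal.inv_mul_cancel hx (measure_ne_top _ _)

lemma kkr_couple {Ω X ι : Type*} [MeasurableSpace Ω] [MeasurableSpace X] [Fintype ι]
    [MeasurableSpace ι] [MeasurableSingletonClass ι] (T : X → ι) (hT : Measurable T)
    (μ ν : Kernel Ω X) [IsMarkovKernel μ] [IsMarkovKernel ν]
    (γ : Ω → ι → ι → ℝ) (mγ : ∀ i j, Measurable fun ω => γ ω i j) (hγ : ∀ ω i j, 0 ≤ γ ω i j)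
    (hr : ∀ ω i, ∑ j, γ ω i j = (μ ω).real (T ⁻¹' {i}))
    (hs : ∀ ω j, ∑ i, γ ω i j = (ν ω).real (T ⁻¹' {j})) :
    ∃ π : Kernel Ω (X × X), IsMarkovKernel π ∧ π.fst = μ ∧ π.snd = ν ∧
      ∀ (h : ι → ι → ℝ≥0∞) ω, ∫⁻ z, h (T z.1) (T z.2) ∂(π ω) =
        ∑ i, ∑ j, h i j * ENNReal.ofReal (γ ω i j) := by
  let G : Ω → ι → ι → ℝ≥0∞ := fun ω i j => ENNReal.ofReal (γ ω i j)
  have hr' : ∀ ω i, ∑ j, G ω i j = μ ω (T ⁻¹' {i}) := by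
    intro ω i
    rw [← ENNReal.ofReal_sum_of_nonneg (fun j _ => hγ ω i j), hr, ofReal_measureReal]
  have hs' : ∀ ω j, ∑ i, G ω i j = ν ω (T ⁻¹' {j}) := by
    intro ω i
    rw [← ENNReal.ofReal_sum_of_nonneg (fun j _ => hγ ω j i), hs, ofReal_measureReal]
  have hr2 : ∀ ω i j, G ω i j ≤ μ ω (T ⁻¹' {i}) := fun ω i j => by
    rw [← hr']; exact Finset.single_le_sum (fun _ _ => zero_le) (Finset.mem_univ j)
  have hs2 : ∀ ω i j, G ω i j ≤ ν ω (T ⁻¹' {j}) := fun ω i j => by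
    rw [← hs']
    exact Finset.single_le_sum (f := fun i => G ω i j) (fun _ _ => zero_le) (Finset.mem_univ i)
  let c : Ω → ι → ι → ℝ≥0∞ := fun ω i j => G ω i j / (μ ω (T ⁻¹' {i}) * ν ω (T ⁻¹' {j}))
  have mc : ∀ i j, Measurable fun ω => c ω i j := by
    intro i j
    have h1 := μ.measurable_coe (hT (measurableSet_singleton i))
    have h2 := ν.measurable_coe (hT (measurableSet_singleton j))
    exact (mγ i j).ennreal_ofReal.div (h1.mul h2)
  have mc2 : Measurable (Function.uncurry fun (ω : Ω) (z : X × X) => c ω (T z.1) (T z.2)) := by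
    have : Measurable (fun w : Ω × (ι × ι) => c w.1 w.2.1 w.2.2) :=
      measurable_from_prod_countable_left fun w => mc w.1 w.2
    exact this.comp (measurable_fst.prodMk ((hT.comp (measurable_fst.comp measurable_snd)).prodMk
      (hT.comp (measurable_snd.comp measurable_snd))))
  have mcω : ∀ ω, Measurable fun z : X × X => c ω (T z.1) (T z.2) := fun ω =>
    mc2.comp (measurable_const.prodMk measurable_id)
  let π : Kernel Ω (X × X) := (μ ×ₖ ν).withDensity fun ω z => c ω (T z.1) (T z.2)
  have hπ : ∀ ω (f : X × X → ℝ≥0∞), Measurable f → ∫⁻ z, f z ∂(π ω) =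
      ∫⁻ z, c ω (T z.1) (T z.2) * f z ∂((μ ω).prod (ν ω)) := by
    intro ω f hf
    rw [Kernel.lintegral_withDensity _ mc2 _ hf, Kernel.prod_apply]
  have hfst : π.fst = μ := by
    ext ω s hs
    have hs3 : MeasurableSet (Prod.fst ⁻¹' s : Set (X × X)) := measurable_fst hs
    rw [Kernel.fst_apply' _ _ hs]
    change π ω (Prod.fst ⁻¹' s) = _
    rw [← lintegral_indicator_one hs3, hπ _ _ (measurable_one.indicator hs3), lintegral_prod
      (fun z => c ω (T z.1) (T z.2) * (Prod.fst ⁻¹' s).indicator 1 z)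
      (((mcω ω).mul (measurable_one.indicator hs3)).aemeasurable)]
    rw [← lintegral_indicator_one hs]
    refine lintegral_congr_ae ?_
    filter_upwards [kkr_marg T hT (μ ω) (ν ω) (G ω) (c ω) (hr' ω) (hs2 ω) (fun _ _ => rfl)] with x hx
    by_cases hxs : x ∈ s
    · simpa [Set.indicator, hxs] using hx
    · simp [Set.indicator, hxs]
  have hsnd : π.snd = ν := by
    ext ω s hs
    have hs3 : MeasurableSet (Prod.snd ⁻¹' s : Set (X × X)) := measurable_snd hs
    rw [Kernel.snd_apply' _ _ hs]
    change π ω (Prod.snd ⁻¹' s) = _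
    rw [← lintegral_indicator_one hs3, hπ _ _ (measurable_one.indicator hs3), lintegral_prod_symm
      (fun z => c ω (T z.1) (T z.2) * (Prod.snd ⁻¹' s).indicator 1 z)
      (((mcω ω).mul (measurable_one.indicator hs3)).aemeasurable)]
    rw [← lintegral_indicator_one hs]
    refine lintegral_congr_ae ?_
    filter_upwards [kkr_marg T hT (ν ω) (μ ω) (fun i j => G ω j i) (fun i j => c ω j i) (hs' ω)
      (fun i j => hr2 ω j i) (fun _ _ => by simp only [c]; rw [mul_comm])] with x hx
    by_cases hxs : x ∈ s
    · simpa [Set.indicator, hxs] using hx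
    · simp [Set.indicator, hxs]
  refine ⟨π, ⟨fun ω => ⟨?_⟩⟩, hfst, hsnd, fun h ω => ?_⟩
  · have := Kernel.fst_apply' π ω MeasurableSet.univ
    rw [hfst] at this
    simpa using this.symm
  · have mh : Measurable fun z : X × X => h (T z.1) (T z.2) := by
      have : Measurable (fun w : ι × ι => h w.1 w.2) := measurable_of_finite _
      exact this.comp ((hT.comp measurable_fst).prodMk (hT.comp measurable_snd))
    rw [hπ _ _ mh, lintegral_prod (fun z => c ω (T z.1) (T z.2) * h (T z.1) (T z.2))
      ((mcω ω).mul mh).aemeasurable]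
    have e1 : ∀ x, ∫⁻ y, c ω (T x) (T y) * h (T x) (T y) ∂(ν ω) =
        ∑ j, c ω (T x) j * h (T x) j * ν ω (T ⁻¹' {j}) := fun x =>
      kkr_lint T hT (ν ω) (fun j => c ω (T x) j * h (T x) j)
    simp only [e1]
    rw [kkr_lint T hT (μ ω) (fun i => ∑ j, c ω i j * h i j * ν ω (T ⁻¹' {j}))]
    refine Finset.sum_congr rfl fun i _ => ?_
    rw [Finset.sum_mul]
    refine Finset.sum_congr rfl fun j _ => ?_
    change _ = h i j * G ω i j
    by_cases h0 : μ ω (T ⁻¹' {i}) * ν ω (T ⁻¹' {j}) = 0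
    · have hG : G ω i j = 0 := by
        rcases mul_eq_zero.1 h0 with h | h
        · exact le_antisymm ((hr2 ω i j).trans h.le) bot_le
        · exact le_antisymm ((hs2 ω i j).trans h.le) bot_le
      simp [c, hG]
    · calc _ = h i j * (c ω i j * (μ ω (T ⁻¹' {i}) * ν ω (T ⁻¹' {j}))) := by ring
        _ = _ := by
          simp only [c]
          rw [ENNReal.div_mul_cancel h0 (ENNReal.mul_ne_top (measure_ne_top _ _)
            (measure_ne_top _ _))]

lemma kkr_easy {Ω X : Type*} [MeasurableSpace Ω] [MetricSpace X] [SecondCountableTopology X]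
    [MeasurableSpace X] [BorelSpace X] (P : Measure Ω)
    (μ ν : Kernel Ω X) (π : Kernel Ω (X × X)) [IsMarkovKernel π] (h1 : π.fst = μ) (h2 : π.snd = ν)
    (ψ : Ω → X → ℝ) (C : ℝ) (hC : ∀ ω x, |ψ ω x| ≤ C) (hL : ∀ ω, LipschitzWith 1 (ψ ω)) :
    ENNReal.ofReal (∫ ω, ((∫ x, ψ ω x ∂(ν ω)) - (∫ x, ψ ω x ∂(μ ω))) ∂P) ≤
      ∫⁻ ω, ∫⁻ q, edist q.1 q.2 ∂(π ω) ∂P := by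
  subst h1 h2
  refine (Real.ofReal_le_enorm _).trans ((enorm_integral_le_lintegral_enorm _).trans ?_)
  refine lintegral_mono fun ω => ?_
  have hm : Measurable (ψ ω) := (hL ω).continuous.measurable
  have i1 : Integrable (fun q : X × X => ψ ω q.2) (π ω) :=
    Integrable.of_bound (hm.comp measurable_snd).aestronglyMeasurable C (ae_of_all _ fun q => hC _ _)
  have i2 : Integrable (fun q : X × X => ψ ω q.1) (π ω) :=
    Integrable.of_bound (hm.comp measurable_fst).aestronglyMeasurable C (ae_of_all _ fun q => hC _ _)
  have e1 : ∫ x, ψ ω x ∂(π.snd ω) = ∫ q, ψ ω q.2 ∂(π ω) := by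
    rw [Kernel.snd_apply, integral_map measurable_snd.aemeasurable hm.aestronglyMeasurable]
  have e2 : ∫ x, ψ ω x ∂(π.fst ω) = ∫ q, ψ ω q.1 ∂(π ω) := by
    rw [Kernel.fst_apply, integral_map measurable_fst.aemeasurable hm.aestronglyMeasurable]
  simp only [e1, e2]
  rw [← integral_sub i1 i2]
  refine (enorm_integral_le_lintegral_enorm _).trans (lintegral_mono fun q => ?_)
  have := (hL ω).edist_le_mul q.2 q.1
  rw [edist_eq_enorm_sub, edist_comm q.2 q.1] at this
  simpa using this

lemma kkr_approx {Ω X : Type*} [MeasurableSpace Ω]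
    [MetricSpace X] [SecondCountableTopology X] [MeasurableSpace X] [BorelSpace X]
    (P : Measure Ω) (x₀ : X) (μ : Kernel Ω X)
    (hμ : ∫⁻ ω, ∫⁻ x, edist x x₀ ∂(μ ω) ∂P < ⊤) :
    Tendsto (fun n => ∫⁻ ω, ∫⁻ x, edist (SimpleFunc.approxOn (id : X → X) measurable_id
      Set.univ x₀ (Set.mem_univ _) n x) x ∂(μ ω) ∂P) atTop (nhds 0) := by
  have key : ∀ f : X → ℝ≥0∞, Measurable f →
      ∫⁻ ω, ∫⁻ x, f x ∂(μ ω) ∂P = ∫⁻ x, f x ∂(P.bind μ) := fun f hf =>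
    (Measure.lintegral_bind μ.measurable.aemeasurable hf.aemeasurable).symm
  have mT : ∀ n, Measurable fun x => edist (SimpleFunc.approxOn (id : X → X) measurable_id
      Set.univ x₀ (Set.mem_univ _) n x) x := fun n => (SimpleFunc.measurable _).edist measurable_id
  rw [key (fun x => edist x x₀) (measurable_id.edist measurable_const)] at hμ
  have := tendsto_lintegral_of_dominated_convergence (μ := P.bind μ) (f := fun _ => 0)
    (F := fun n x => edist (SimpleFunc.approxOn (id : X → X) measurable_id
      Set.univ x₀ (Set.mem_univ _) n x) x) (fun x => edist x x₀) mT
    (fun n => ae_of_all _ fun x => by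
      change edist _ x ≤ edist x x₀
      rw [edist_comm x x₀]
      exact SimpleFunc.edist_approxOn_le measurable_id (Set.mem_univ x₀) x n) hμ.ne
    (ae_of_all _ fun x => by
      have := SimpleFunc.tendsto_approxOn (f := (id : X → X)) measurable_id (Set.mem_univ x₀)
        (x := x) (by simp)
      have h := this.edist (tendsto_const_nhds (x := x))
      simpa using h)
  simp only [lintegral_zero] at this
  refine this.congr fun n => ?_
  rw [key _ (mT n)]

lemma kkr_extend {X : Type*} [MetricSpace X] (s : Finset X) (f : s → ℝ) (hf : LipschitzWith 1 f)
    (D : ℝ) (hfD : ∀ i, |f i| ≤ D) (hD0 : 0 ≤ D) :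
    ∃ g : X → ℝ, LipschitzWith 1 g ∧ (∀ x, |g x| ≤ D) ∧ ∀ i : s, g i = f i := by
  classical
  let f0 : X → ℝ := fun x => if h : x ∈ s then f ⟨x, h⟩ else 0
  have hf0 : LipschitzOnWith 1 f0 (s : Set X) := by
    intro x hx y hy
    have hx' : x ∈ s := hx
    have hy' : y ∈ s := hy
    have := hf ⟨x, hx'⟩ ⟨y, hy'⟩
    simpa [f0, hx', hy'] using this
  obtain ⟨g, hg, he⟩ := hf0.extend_real
  refine ⟨fun x => max (-D) (min D (g x)), (hg.const_min D).const_max (-D), fun x => ?_, fun i => ?_⟩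
  · rw [abs_le]
    exact ⟨le_max_left _ _, max_le (by linarith) (min_le_left _ _)⟩
  · have h1 : g i = f i := by
      rw [← he i.2]
      simp [f0]
    have := abs_le.1 (hfD i)
    simp only [h1]
    rw [min_eq_right this.2, max_eq_right this.1]

lemma kkr_hard {Ω X : Type*} [MeasurableSpace Ω]
    [MetricSpace X] [SecondCountableTopology X] [MeasurableSpace X] [BorelSpace X]
    (P : Measure Ω) [IsProbabilityMeasure P]
    (μ ν : Kernel Ω X) [IsMarkovKernel μ] [IsMarkovKernel ν] (T : SimpleFunc X X)
    (δ : ℝ) (hδ : 0 < δ) :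
    ∃ π : Kernel Ω (X × X), ∃ ψ : Ω → X → ℝ, (IsMarkovKernel π ∧ π.fst = μ ∧ π.snd = ν) ∧
      (Measurable (fun q : Ω × X => ψ q.1 q.2) ∧
          (∃ C : ℝ, ∀ ω x, |ψ ω x| ≤ C) ∧ ∀ ω, LipschitzWith 1 (ψ ω)) ∧
      ∫⁻ ω, ∫⁻ q, edist q.1 q.2 ∂(π ω) ∂P ≤
        ENNReal.ofReal (∫ ω, ((∫ x, ψ ω x ∂(ν ω)) - (∫ x, ψ ω x ∂(μ ω))) ∂P) +
        (∫⁻ ω, ∫⁻ x, edist (T x) x ∂(μ ω) ∂P + ∫⁻ ω, ∫⁻ x, edist (T x) x ∂(ν ω) ∂P +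
         ∫⁻ ω, ∫⁻ x, edist (T x) x ∂(μ ω) ∂P + ∫⁻ ω, ∫⁻ x, edist (T x) x ∂(ν ω) ∂P +
         ENNReal.ofReal δ) := by
  classical
  let ι := {x // x ∈ T.range}
  let τ : X → ι := fun x => ⟨T x, T.mem_range_self x⟩
  have hτ : Measurable τ := T.measurable.subtype_mk
  have hsum : ∀ (κ : Kernel Ω X) [IsMarkovKernel κ] (ω : Ω) (f : ι → ℝ),
      ∑ i, f i * (κ ω).real (τ ⁻¹' {i}) = ∫ x, f (τ x) ∂(κ ω) := by
    intro κ _ ω f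
    have := Measure.isProbabilityMeasure_map (μ := κ ω) hτ.aemeasurable
    rw [← integral_map (f := f) hτ.aemeasurable
      (measurable_of_finite f).aestronglyMeasurable, integral_fintype Integrable.of_finite]
    refine Finset.sum_congr rfl fun i _ => ?_
    rw [map_measureReal_apply hτ (measurableSet_singleton i), smul_eq_mul, mul_comm]
  have hone : ∀ (κ : Kernel Ω X) [IsMarkovKernel κ] (ω : Ω),
      ∑ i, (κ ω).real (τ ⁻¹' {i}) = 1 := by
    intro κ _ ω
    have := hsum κ ω (fun _ => 1)
    simpa using this
  have hmeas : ∀ (κ : Kernel Ω X) (i : ι), Measurable fun ω => (κ ω).real (τ ⁻¹' {i}) :=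
    fun κ i => (κ.measurable_coe (hτ (measurableSet_singleton i))).ennreal_toReal
  obtain ⟨D, hD0, hD⟩ : ∃ D : ℝ, 0 ≤ D ∧ ∀ i j : ι, dist i j ≤ D :=
    ⟨Metric.diam (Set.univ : Set ι), Metric.diam_nonneg, fun i j =>
      Metric.dist_le_diam_of_mem Set.finite_univ.isBounded (Set.mem_univ _) (Set.mem_univ _)⟩
  obtain ⟨γ, F, n, mγ, mn, hF, hsel⟩ := kkr_sel (fun ω i => (μ ω).real (τ ⁻¹' {i}))
    (fun ω i => (ν ω).real (τ ⁻¹' {i})) (hmeas μ) (hmeas ν) (fun _ _ => measureReal_nonneg)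
    (fun _ _ => measureReal_nonneg) (hone μ) (hone ν) D hD0 hD δ hδ
  obtain ⟨π, hπM, hπ1, hπ2, hπ⟩ := kkr_couple τ hτ μ ν γ mγ (fun ω => (hsel ω).1)
    (fun ω => (hsel ω).2.1) (fun ω => (hsel ω).2.2.1)
  choose g hgL hgD hgF using fun k => kkr_extend T.range (F k) (hF k).1 D (hF k).2 hD0
  let ψ : Ω → X → ℝ := fun ω => g (n ω)
  have mψ : Measurable (fun q : Ω × X => ψ q.1 q.2) := by
    have : Measurable (fun w : ℕ × X => g w.1 w.2) :=
      measurable_from_prod_countable_right fun k => (hgL k).continuous.measurable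
    exact this.comp ((mn.comp measurable_fst).prodMk measurable_snd)
  have mψT : Measurable (fun q : Ω × X => ψ q.1 (T q.2)) :=
    mψ.comp (measurable_fst.prodMk (T.measurable.comp measurable_snd))
  refine ⟨π, ψ, ⟨hπM, hπ1, hπ2⟩, ⟨mψ, ⟨D, fun ω x => hgD _ x⟩, fun ω => hgL _⟩, ?_⟩
  -- integrability of fibre integrals
  have hint : ∀ (κ : Kernel Ω X) [IsMarkovKernel κ] (φ : Ω → X → ℝ),
      Measurable (fun q : Ω × X => φ q.1 q.2) → (∀ ω x, |φ ω x| ≤ D) →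
      Integrable (fun ω => ∫ x, φ ω x ∂(κ ω)) P := by
    intro κ _ φ hφ hb
    refine Integrable.of_bound
      (StronglyMeasurable.integral_kernel_prod_right hφ.stronglyMeasurable).aestronglyMeasurable D
      (ae_of_all _ fun ω => ?_)
    have := norm_integral_le_of_norm_le_const (μ := κ ω) (f := fun x => φ ω x) (C := D)
      (ae_of_all _ fun x => hb ω x)
    simpa using this
  have hdiff : ∀ (κ : Kernel Ω X) [IsMarkovKernel κ],
      ‖∫ ω, ((∫ x, ψ ω (T x) ∂(κ ω)) - ∫ x, ψ ω x ∂(κ ω)) ∂P‖ₑ ≤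
        ∫⁻ ω, ∫⁻ x, edist (T x) x ∂(κ ω) ∂P := by
    intro κ _
    refine (enorm_integral_le_lintegral_enorm _).trans (lintegral_mono fun ω => ?_)
    have m1 : Measurable (ψ ω) := (hgL _).continuous.measurable
    have j1 : Integrable (fun x => ψ ω (T x)) (κ ω) :=
      Integrable.of_bound (m1.comp T.measurable).aestronglyMeasurable D
        (ae_of_all _ fun q => hgD _ _)
    have j2 : Integrable (fun x => ψ ω x) (κ ω) :=
      Integrable.of_bound m1.aestronglyMeasurable D (ae_of_all _ fun q => hgD _ _)
    rw [← integral_sub j1 j2]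
    refine (enorm_integral_le_lintegral_enorm _).trans (lintegral_mono fun x => ?_)
    have := (hgL (n ω)).edist_le_mul (T x) x
    rw [edist_eq_enorm_sub] at this
    simpa using this
  -- the discretised objective
  have hobj : ∀ ω, ∑ i, F (n ω) i * ((ν ω).real (τ ⁻¹' {i}) - (μ ω).real (τ ⁻¹' {i})) =
      (∫ x, ψ ω (T x) ∂(ν ω)) - ∫ x, ψ ω (T x) ∂(μ ω) := by
    intro ω
    simp only [mul_sub, Finset.sum_sub_distrib]
    rw [hsum ν, hsum μ]
    have : ∀ x, F (n ω) (τ x) = ψ ω (T x) := fun x => (hgF (n ω) (τ x)).symm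
    simp only [this]
  have mT : Measurable fun x => edist (T x) x := T.measurable.edist measurable_id
  -- pointwise bound
  have hpt : ∀ ω, ∫⁻ q, edist q.1 q.2 ∂(π ω) ≤
      ∫⁻ x, edist (T x) x ∂(μ ω) + ∫⁻ x, edist (T x) x ∂(ν ω) +
      ENNReal.ofReal (((∫ x, ψ ω (T x) ∂(ν ω)) - ∫ x, ψ ω (T x) ∂(μ ω)) + δ) := by
    intro ω
    have e1 : ∫⁻ x, edist (T x) x ∂(μ ω) = ∫⁻ q, edist (T q.1) q.1 ∂(π ω) := by
      rw [← hπ1, Kernel.fst_apply, lintegral_map mT measurable_fst]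
    have e2 : ∫⁻ x, edist (T x) x ∂(ν ω) = ∫⁻ q, edist (T q.2) q.2 ∂(π ω) := by
      rw [← hπ2, Kernel.snd_apply, lintegral_map mT measurable_snd]
    have e3 := hπ (fun i j => edist i j) ω
    have e4 : ∑ i, ∑ j, edist i j * ENNReal.ofReal (γ ω i j) =
        ENNReal.ofReal (∑ i, ∑ j, γ ω i j * dist i j) := by
      rw [ENNReal.ofReal_sum_of_nonneg (fun i _ => Finset.sum_nonneg fun j _ =>
        mul_nonneg ((hsel ω).1 i j) dist_nonneg)]
      refine Finset.sum_congr rfl fun i _ => ?_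
      rw [ENNReal.ofReal_sum_of_nonneg (fun j _ => mul_nonneg ((hsel ω).1 i j) dist_nonneg)]
      refine Finset.sum_congr rfl fun j _ => ?_
      rw [ENNReal.ofReal_mul ((hsel ω).1 i j), ← edist_dist, mul_comm]
    rw [e4] at e3
    rw [e1, e2, ← hobj]
    refine le_trans ?_ (add_le_add_right (ENNReal.ofReal_le_ofReal (hsel ω).2.2.2) _)
    have m1 : Measurable fun q : X × X => edist (T q.1) q.1 := mT.comp measurable_fst
    have m2 : Measurable fun q : X × X => edist (T q.2) q.2 := mT.comp measurable_snd
    have m3 : Measurable fun q : X × X => edist (T q.1) q.1 + edist (T q.2) q.2 := m1.add m2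
    rw [← e3, ← lintegral_add_left m1, ← lintegral_add_left m3]
    refine lintegral_mono fun q => ?_
    change edist q.1 q.2 ≤ edist (T q.1) q.1 + edist (T q.2) q.2 + edist (T q.1) (T q.2)
    calc edist q.1 q.2 ≤ edist q.1 (T q.1) + edist (T q.1) (T q.2) + edist (T q.2) q.2 :=
          edist_triangle4 _ _ _ _
      _ = _ := by rw [edist_comm q.1]; ring
  have hnn : ∀ ω, 0 ≤ ((∫ x, ψ ω (T x) ∂(ν ω)) - ∫ x, ψ ω (T x) ∂(μ ω)) + δ := by
    intro ω
    rw [← hobj]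
    refine le_trans ?_ (hsel ω).2.2.2
    exact Finset.sum_nonneg fun i _ => Finset.sum_nonneg fun j _ =>
      mul_nonneg ((hsel ω).1 i j) dist_nonneg
  have iν := hint ν ψ mψ (fun ω x => hgD _ x)
  have iμ := hint μ ψ mψ (fun ω x => hgD _ x)
  have iνT := hint ν (fun ω x => ψ ω (T x)) mψT (fun ω x => hgD _ _)
  have iμT := hint μ (fun ω x => ψ ω (T x)) mψT (fun ω x => hgD _ _)
  have ma : ∀ (κ : Kernel Ω X), Measurable fun ω => ∫⁻ x, edist (T x) x ∂(κ ω) :=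
    fun κ => mT.lintegral_kernel
  refine (lintegral_mono hpt).trans ?_
  have m4 : Measurable fun ω => ∫⁻ x, edist (T x) x ∂(μ ω) + ∫⁻ x, edist (T x) x ∂(ν ω) :=
    (ma μ).add (ma ν)
  have i4 : Integrable (fun ω => ((∫ x, ψ ω (T x) ∂(ν ω)) - ∫ x, ψ ω (T x) ∂(μ ω)) + δ) P :=
    (iνT.sub iμT).add (integrable_const δ)
  rw [lintegral_add_left m4, lintegral_add_left (ma μ),
    ← ofReal_integral_eq_lintegral_ofReal i4 (ae_of_all _ hnn)]
  have hfin : ENNReal.ofReal (∫ ω, (((∫ x, ψ ω (T x) ∂(ν ω)) - ∫ x, ψ ω (T x) ∂(μ ω)) + δ) ∂P) ≤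
      ENNReal.ofReal (∫ ω, ((∫ x, ψ ω x ∂(ν ω)) - (∫ x, ψ ω x ∂(μ ω))) ∂P) +
      (∫⁻ ω, ∫⁻ x, edist (T x) x ∂(μ ω) ∂P + ∫⁻ ω, ∫⁻ x, edist (T x) x ∂(ν ω) ∂P +
        ENNReal.ofReal δ) := by
    have hν' := hdiff ν
    have hμ' := hdiff μ
    rw [integral_sub iνT iν] at hν'
    rw [integral_sub iμT iμ] at hμ'
    have hsp : ∫ ω, (((∫ x, ψ ω (T x) ∂(ν ω)) - ∫ x, ψ ω (T x) ∂(μ ω)) + δ) ∂P =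
        (∫ ω, ∫ x, ψ ω (T x) ∂(ν ω) ∂P) - (∫ ω, ∫ x, ψ ω (T x) ∂(μ ω) ∂P) + δ := by
      have i5 : Integrable (fun ω => (∫ x, ψ ω (T x) ∂(ν ω)) - ∫ x, ψ ω (T x) ∂(μ ω)) P :=
        iνT.sub iμT
      rw [integral_add i5 (integrable_const δ), integral_sub iνT iμT]
      simp
    rw [hsp, integral_sub iν iμ]
    set a := ∫ ω, ∫ x, ψ ω (T x) ∂(ν ω) ∂P
    set b := ∫ ω, ∫ x, ψ ω (T x) ∂(μ ω) ∂P
    set a' := ∫ ω, ∫ x, ψ ω x ∂(ν ω) ∂P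
    set b' := ∫ ω, ∫ x, ψ ω x ∂(μ ω) ∂P
    have : a - b + δ = (a' - b') + ((-(b - b') + (a - a')) + δ) := by ring
    rw [this]
    refine ENNReal.ofReal_add_le.trans (add_le_add_right (ENNReal.ofReal_add_le.trans
      (add_le_add_left (ENNReal.ofReal_add_le.trans (add_le_add ?_ ?_)) _)) _)
    · refine (Real.ofReal_le_enorm _).trans ?_
      rwa [enorm_neg]
    · exact (Real.ofReal_le_enorm _).trans hν'
  refine (add_le_add_right hfin _).trans (le_of_eq ?_)
  ring

/-- **Kantorovich–Rubinstein duality for probability kernels.** For probability kernels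
`μ, ν` from `Ω` to a Polish metric space `X` with finite first moments,
`W_1(μ,ν) = sup_ψ E( ∫ ψ(ω,x) ν_ω(dx) − ∫ ψ(ω,x) μ_ω(dx) )`,
the supremum being over all bounded jointly measurable `ψ : Ω × X → ℝ` which are
`1`-Lipschitz in `x` for each `ω`. -/
theorem kernel_kantorovich_rubinstein
    {Ω X : Type*} [MeasurableSpace Ω]
    [MetricSpace X] [CompleteSpace X] [SecondCountableTopology X]
    [MeasurableSpace X] [BorelSpace X]
    (P : Measure Ω) [IsProbabilityMeasure P]
    (x₀ : X)
    (μ ν : Kernel Ω X) [IsMarkovKernel μ] [IsMarkovKernel ν]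
    (hμ : ∫⁻ ω, ∫⁻ x, edist x x₀ ∂(μ ω) ∂P < ⊤)
    (hν : ∫⁻ ω, ∫⁻ x, edist x x₀ ∂(ν ω) ∂P < ⊤) :
    (⨅ π ∈ {π : Kernel Ω (X × X) | IsMarkovKernel π ∧ π.fst = μ ∧ π.snd = ν},
        ∫⁻ ω, ∫⁻ q, edist q.1 q.2 ∂(π ω) ∂P) =
      ⨆ ψ : {ψ : Ω → X → ℝ // Measurable (fun q : Ω × X => ψ q.1 q.2) ∧
          (∃ C : ℝ, ∀ ω x, |ψ ω x| ≤ C) ∧ ∀ ω, LipschitzWith 1 (ψ ω)},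
        ENNReal.ofReal
          (∫ ω, ((∫ x, ψ.1 ω x ∂(ν ω)) - (∫ x, ψ.1 ω x ∂(μ ω))) ∂P) := by
  refine le_antisymm ?_ ?_
  · refine ENNReal.le_of_forall_pos_le_add fun ε hε _ => ?_
    have h5 : (0 : ℝ≥0∞) < ((ε / 5 : NNReal) : ℝ≥0∞) := by
      rw [ENNReal.coe_pos]; positivity
    obtain ⟨n, hn1, hn2⟩ := (((kkr_approx P x₀ μ hμ).eventually (ge_mem_nhds h5)).and
      ((kkr_approx P x₀ ν hν).eventually (ge_mem_nhds h5))).exists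
    obtain ⟨π, ψ, hπ, hψ, hle⟩ := kkr_hard P μ ν (SimpleFunc.approxOn (id : X → X) measurable_id
      Set.univ x₀ (Set.mem_univ _) n) ((ε / 5 : NNReal) : ℝ) (by positivity)
    refine (iInf₂_le π hπ).trans (hle.trans ?_)
    refine add_le_add (le_iSup (fun ψ : {ψ : Ω → X → ℝ // Measurable (fun q : Ω × X => ψ q.1 q.2) ∧
          (∃ C : ℝ, ∀ ω x, |ψ ω x| ≤ C) ∧ ∀ ω, LipschitzWith 1 (ψ ω)} => ENNReal.ofReal
          (∫ ω, ((∫ x, ψ.1 ω x ∂(ν ω)) - (∫ x, ψ.1 ω x ∂(μ ω))) ∂P)) ⟨ψ, hψ⟩) ?_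
    rw [ENNReal.ofReal_coe_nnreal]
    refine (add_le_add_left (add_le_add (add_le_add (add_le_add hn1 hn2) hn1) hn2) _).trans ?_
    norm_cast
    refine le_of_eq ?_
    ext
    push_cast
    ring
  · refine iSup_le fun ψ => le_iInf₂ fun π hπ => ?_
    obtain ⟨ψ, hm, ⟨C, hC⟩, hL⟩ := ψ
    obtain ⟨h0, h1, h2⟩ := hπ
    exact kkr_easy P μ ν π h1 h2 ψ C hC hL
end

section
/- Let X and Y be Polish spaces with fixed base points x_0 ∈ X, y_0 ∈ Y, let M be the metric space of triples (c,μ,ν) where c : X×Y → [0,∞) is continuous, μ ∈ P(X), ν ∈ P(Y) and ∫_{X×Y} c dμ dν < ∞, with the distance given by the sum of the metric of uniform convergence of c on products of closed balls B^m_X(x_0) × B^m_Y(y_0) and metrics of weak convergence on P(X) and P(Y). For m ∈ ℕ let M_m := {(c,μ,ν) ∈ M : ∫ c dμ dν ≤ m}, and let Φ(c,μ,ν) ⊂ P(X×Y) be the (nonempty, compact) set of all optimal transference plans for (c,μ,ν). Then for every closed set A ⊂ P(X×Y) and every m ∈ ℕ, the set {(c,μ,ν) ∈ M_m : Φ(c,μ,ν)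 ∩ A ≠ ∅} is a closed subset of M. -/
open MeasureTheory ProbabilityTheory Filter Topology ENNReal

/-- The deterministic Monge–Kantorovich cost `C^deter(c,μ,ν)`: the infimum over all
couplings `π ∈ Π(μ,ν)` of `∫ c dπ`. -/
noncomputable def deterCost {X Y : Type*} [MeasurableSpace X] [MeasurableSpace Y]
    (c : X → Y → ℝ) (μ : Measure X) (ν : Measure Y) : ℝ≥0∞ :=
  ⨅ π ∈ {π : Measure (X × Y) | IsProbabilityMeasure π ∧ π.fst = μ ∧ π.snd = ν},
    ∫⁻ q, ENNReal.ofReal (c q.1 q.2) ∂π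

/-- `c`-cyclical monotonicity of a set. -/
def CycMono {X Y : Type*} (c : X → Y → ℝ) (S : Set (X × Y)) : Prop :=
  ∀ (N : ℕ) (q : Fin N → X × Y) (σ : Equiv.Perm (Fin N)), (∀ i, q i ∈ S) →
    ∑ i, c (q i).1 (q i).2 ≤ ∑ i, c (q i).1 (q (σ i)).2

lemma fst_finset_sum {X Y : Type*} [MeasurableSpace X] [MeasurableSpace Y] {ι : Type*}
    (s : Finset ι) (l : ι → Measure (X × Y)) :
    (∑ i ∈ s, l i).fst = ∑ i ∈ s, (l i).fst := by
  classical
  induction s using Finset.induction_on with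
  | empty => simp
  | insert a s ha ih => simp [Finset.sum_insert ha, ih]

lemma snd_finset_sum {X Y : Type*} [MeasurableSpace X] [MeasurableSpace Y] {ι : Type*}
    (s : Finset ι) (l : ι → Measure (X × Y)) :
    (∑ i ∈ s, l i).snd = ∑ i ∈ s, (l i).snd := by
  classical
  induction s using Finset.induction_on with
  | empty => simp
  | insert a s ha ih => simp [Finset.sum_insert ha, ih]

lemma fst_smul_measure {X Y : Type*} [MeasurableSpace X] [MeasurableSpace Y]
    (a : ℝ≥0∞) (l : Measure (X × Y)) : (a • l).fst = a • l.fst := by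
  simp [Measure.fst, Measure.map_smul]

lemma snd_smul_measure {X Y : Type*} [MeasurableSpace X] [MeasurableSpace Y]
    (a : ℝ≥0∞) (l : Measure (X × Y)) : (a • l).snd = a • l.snd := by
  simp [Measure.snd, Measure.map_smul]

lemma swap_cost {X Y : Type*} [MeasurableSpace X] [MeasurableSpace Y]
    (c : X → Y → ℝ) (π : Measure (X × Y)) [IsProbabilityMeasure π]
    (hopt : ∫⁻ q, ENNReal.ofReal (c q.1 q.2) ∂π = deterCost c π.fst π.snd)
    (hfin : ∫⁻ q, ENNReal.ofReal (c q.1 q.2) ∂π ≠ ⊤)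
    {N : ℕ} (hN : N ≠ 0) (l : Fin N → Measure (X × Y)) [hl : ∀ i, IsProbabilityMeasure (l i)]
    (C : ℝ≥0∞) (hC0 : C ≠ 0) (hC : C ≠ ⊤) (hlC : ∀ i, l i ≤ C • π) (σ : Equiv.Perm (Fin N)) :
    ∑ i, ∫⁻ q, ENNReal.ofReal (c q.1 q.2) ∂(l i) ≤
      ∑ i, ∫⁻ q, ENNReal.ofReal (c q.1 q.2) ∂((l i).fst.prod (l (σ i)).snd) := by
  set δ : ℝ≥0∞ := (N * C)⁻¹ with hδ
  have hNC0 : (N : ℝ≥0∞) * C ≠ 0 := mul_ne_zero (by exact_mod_cast hN) hC0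
  have hNCt : (N : ℝ≥0∞) * C ≠ ⊤ := ENNReal.mul_ne_top (by simp) hC
  have hδ0 : δ ≠ 0 := ENNReal.inv_ne_zero.2 hNCt
  have hδt : δ ≠ ⊤ := ENNReal.inv_ne_top.2 hNC0
  set τ : Measure (X × Y) := δ • ∑ i, l i with hτ
  set τ' : Measure (X × Y) := δ • ∑ i, (l i).fst.prod (l (σ i)).snd with hτ'
  have hle : τ ≤ π := by
    have h1 : ∑ i, l i ≤ (N * C) • π := by
      calc ∑ i, l i ≤ ∑ i : Fin N, C • π := Finset.sum_le_sum fun i _ => hlC i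
        _ = (N * C) • π := by
          simp [mul_smul, Nat.cast_smul_eq_nsmul]
    calc τ ≤ δ • ((N * C) • π) := by
          rw [hτ]; gcongr
      _ = π := by rw [smul_smul, hδ, ENNReal.inv_mul_cancel hNC0 hNCt, one_smul]
  have : IsFiniteMeasure τ := isFiniteMeasure_of_le π hle
  set ρ := π - τ with hρ
  have hρτ : ρ + τ = π := Measure.sub_add_cancel_of_le hle
  have hfst : (ρ + τ').fst = π.fst := by
    rw [← hρτ]
    simp only [hτ, hτ', Measure.fst_add, fst_smul_measure, fst_finset_sum, Measure.fst_prod]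
  have hsnd : (ρ + τ').snd = π.snd := by
    rw [← hρτ]
    simp only [hτ, hτ', Measure.snd_add, snd_smul_measure, snd_finset_sum, Measure.snd_prod]
    rw [Equiv.sum_comp σ (fun i => (l i).snd)]
  have hprob : IsProbabilityMeasure (ρ + τ') := by
    constructor
    rw [← Measure.fst_univ, hfst, Measure.fst_univ, measure_univ]
  have h1 : ∫⁻ q, ENNReal.ofReal (c q.1 q.2) ∂π ≤ ∫⁻ q, ENNReal.ofReal (c q.1 q.2) ∂(ρ + τ') := by
    rw [hopt]
    exact iInf₂_le (ρ + τ') ⟨hprob, hfst, hsnd⟩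
  have hρfin : ∫⁻ q, ENNReal.ofReal (c q.1 q.2) ∂ρ ≠ ⊤ := by
    refine ne_top_of_le_ne_top hfin ?_
    rw [← hρτ, lintegral_add_measure]
    exact le_self_add
  conv_lhs at h1 => rw [← hρτ]
  rw [lintegral_add_measure, lintegral_add_measure, ENNReal.add_le_add_iff_left hρfin,
    hτ, hτ', lintegral_smul_measure, lintegral_smul_measure, lintegral_finsetSum_measure,
    lintegral_finsetSum_measure, smul_eq_mul, smul_eq_mul,
    ENNReal.mul_le_mul_iff_right hδ0 hδt] at h1
  exact h1

lemma cycMono_of_optimal {X Y : Type*}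
    [MetricSpace X] [SecondCountableTopology X] [MeasurableSpace X] [BorelSpace X]
    [MetricSpace Y] [SecondCountableTopology Y] [MeasurableSpace Y] [BorelSpace Y]
    (c : X → Y → ℝ) (hc : Continuous (fun q : X × Y => c q.1 q.2)) (hc0 : ∀ x y, 0 ≤ c x y)
    (π : Measure (X × Y)) [IsProbabilityMeasure π]
    (hopt : ∫⁻ q, ENNReal.ofReal (c q.1 q.2) ∂π = deterCost c π.fst π.snd)
    (hfin : ∫⁻ q, ENNReal.ofReal (c q.1 q.2) ∂π ≠ ⊤) : CycMono c π.support := by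
  intro N q σ hq
  rcases eq_or_ne N 0 with rfl | hN
  · simp
  refine le_of_forall_pos_le_add fun ε' hε' => ?_
  obtain ⟨ε, hε, hεε⟩ : ∃ ε : ℝ, 0 < ε ∧ N * ε + N * ε = ε' := by
    have : (0:ℝ) < N := by exact_mod_cast Nat.pos_of_ne_zero hN
    exact ⟨ε' / (2 * N), by positivity, by field_simp; norm_num⟩
  have key : ∀ z : X × Y, ∀ᶠ r in 𝓝[>] (0:ℝ), ∀ w, dist w z < r →
      |c w.1 w.2 - c z.1 z.2| < ε := by
    intro z
    obtain ⟨d, hd, h⟩ := Metric.continuous_iff.1 hc z ε hε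
    filter_upwards [Ioo_mem_nhdsGT hd] with r hr w hw
    exact h w (hw.trans hr.2)
  obtain ⟨r, ⟨h1, h2⟩, hr⟩ := (((eventually_all.2 fun i => key (q i)).and
    (eventually_all.2 fun i => key ((q i).1, (q (σ i)).2))).and self_mem_nhdsWithin).exists
  have hr : 0 < r := hr
  have hp : ∀ i, π (Metric.ball (q i) r) ≠ 0 := fun i =>
    ((Measure.mem_support_iff_forall _).1 (hq i) _ (Metric.ball_mem_nhds _ hr)).ne'
  have hl : ∀ i, IsProbabilityMeasure (π[|Metric.ball (q i) r]) := fun i =>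
    cond_isProbabilityMeasure (hp i)
  have main := swap_cost c π hopt hfin hN (fun i => π[|Metric.ball (q i) r])
    (∑ i, (π (Metric.ball (q i) r))⁻¹)
    (by
      intro h
      have := (Finset.sum_eq_zero_iff.1 h) ⟨0, Nat.pos_of_ne_zero hN⟩ (Finset.mem_univ _)
      simp at this)
    (by
      refine (ENNReal.sum_lt_top.2 fun i _ => ?_).ne
      exact (ENNReal.inv_ne_top.2 (hp i)).lt_top)
    (by
      intro i
      have h : (π (Metric.ball (q i) r))⁻¹ ≤ ∑ i, (π (Metric.ball (q i) r))⁻¹ :=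
        Finset.single_le_sum (f := fun i => (π (Metric.ball (q i) r))⁻¹)
          (fun _ _ => zero_le) (Finset.mem_univ i)
      simp only [ProbabilityTheory.cond]
      calc (π (Metric.ball (q i) r))⁻¹ • π.restrict (Metric.ball (q i) r)
          ≤ (π (Metric.ball (q i) r))⁻¹ • π := by gcongr; exact Measure.restrict_le_self
        _ ≤ _ := by gcongr) σ
  have hae : ∀ i, ∀ᵐ w ∂(π[|Metric.ball (q i) r]), w ∈ Metric.ball (q i) r := fun i =>
    ae_cond_mem Metric.isOpen_ball.measurableSet
  have lower : ∀ i, ENNReal.ofReal (c (q i).1 (q i).2) ≤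
      ∫⁻ w, ENNReal.ofReal (c w.1 w.2) ∂(π[|Metric.ball (q i) r]) + ENNReal.ofReal ε := by
    intro i
    calc ENNReal.ofReal (c (q i).1 (q i).2)
        = ∫⁻ w, ENNReal.ofReal (c (q i).1 (q i).2) ∂(π[|Metric.ball (q i) r]) := by simp
      _ ≤ ∫⁻ w, (ENNReal.ofReal (c w.1 w.2) + ENNReal.ofReal ε) ∂(π[|Metric.ball (q i) r]) := by
          refine lintegral_mono_ae ?_
          filter_upwards [hae i] with w hw
          rw [← ENNReal.ofReal_add (hc0 _ _) hε.le]
          have := abs_lt.1 (h1 i w hw)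
          exact ENNReal.ofReal_le_ofReal (by linarith)
      _ = _ := by rw [lintegral_add_right _ measurable_const]; simp
  have upper : ∀ i, ∫⁻ w, ENNReal.ofReal (c w.1 w.2)
        ∂((π[|Metric.ball (q i) r]).fst.prod (π[|Metric.ball (q (σ i)) r]).snd) ≤
      ENNReal.ofReal (c (q i).1 (q (σ i)).2) + ENNReal.ofReal ε := by
    intro i
    have e1 : ∀ᵐ x ∂(π[|Metric.ball (q i) r]).fst, x ∈ Metric.ball (q i).1 r := by
      refine (ae_map_iff measurable_fst.aemeasurable Metric.isOpen_ball.measurableSet).2 ?_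
      filter_upwards [hae i] with w hw
      exact (le_max_left _ _).trans_lt hw
    have e2 : ∀ᵐ x ∂(π[|Metric.ball (q (σ i)) r]).snd, x ∈ Metric.ball (q (σ i)).2 r := by
      refine (ae_map_iff measurable_snd.aemeasurable Metric.isOpen_ball.measurableSet).2 ?_
      filter_upwards [hae (σ i)] with w hw
      exact (le_max_right _ _).trans_lt hw
    have e3 := Measure.quasiMeasurePreserving_fst.ae (μb := (π[|Metric.ball (q i) r]).fst)
      (μa := (π[|Metric.ball (q i) r]).fst.prod (π[|Metric.ball (q (σ i)) r]).snd) e1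
    have e4 := Measure.quasiMeasurePreserving_snd.ae (μb := (π[|Metric.ball (q (σ i)) r]).snd)
      (μa := (π[|Metric.ball (q i) r]).fst.prod (π[|Metric.ball (q (σ i)) r]).snd) e2
    calc _ ≤ ∫⁻ w, (ENNReal.ofReal (c (q i).1 (q (σ i)).2) + ENNReal.ofReal ε)
          ∂((π[|Metric.ball (q i) r]).fst.prod (π[|Metric.ball (q (σ i)) r]).snd) := by
          refine lintegral_mono_ae ?_
          filter_upwards [e3, e4] with w hw1 hw2
          rw [← ENNReal.ofReal_add (hc0 _ _) hε.le]
          have := abs_lt.1 (h2 i w (max_lt hw1 hw2))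
          exact ENNReal.ofReal_le_ofReal (by linarith)
      _ = _ := by simp
  have fin : ENNReal.ofReal (∑ i, c (q i).1 (q i).2) ≤
      ENNReal.ofReal (∑ i, c (q i).1 (q (σ i)).2 + ε') := by
    have hs : 0 ≤ ∑ i, c (q i).1 (q (σ i)).2 := Finset.sum_nonneg fun i _ => hc0 _ _
    rw [← hεε, ENNReal.ofReal_add hs (by positivity), ENNReal.ofReal_add (by positivity) (by positivity),
      ENNReal.ofReal_mul (by positivity), ENNReal.ofReal_natCast,
      ENNReal.ofReal_sum_of_nonneg (fun i _ => hc0 _ _),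
      ENNReal.ofReal_sum_of_nonneg (fun i _ => hc0 _ _), ← add_assoc]
    calc _ ≤ ∑ i, (∫⁻ w, ENNReal.ofReal (c w.1 w.2) ∂(π[|Metric.ball (q i) r])
              + ENNReal.ofReal ε) := Finset.sum_le_sum fun i _ => lower i
      _ = ∑ i, ∫⁻ w, ENNReal.ofReal (c w.1 w.2) ∂(π[|Metric.ball (q i) r])
              + N * ENNReal.ofReal ε := by simp [Finset.sum_add_distrib]
      _ ≤ ∑ i, (ENNReal.ofReal (c (q i).1 (q (σ i)).2) + ENNReal.ofReal ε)
              + N * ENNReal.ofReal ε := by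
          exact add_le_add_left (main.trans (Finset.sum_le_sum fun i _ => upper i)) _
      _ = _ := by simp [Finset.sum_add_distrib]
  exact (ENNReal.ofReal_le_ofReal_iff (add_nonneg (Finset.sum_nonneg fun i _ => hc0 _ _) hε'.le)).1 fin

lemma cycMono_limit {X Y : Type*}
    [MetricSpace X] [SecondCountableTopology X] [MeasurableSpace X] [BorelSpace X]
    [MetricSpace Y] [SecondCountableTopology Y] [MeasurableSpace Y] [BorelSpace Y]
    (x₀ : X) (y₀ : Y)
    (cn : ℕ → X → Y → ℝ) (c : X → Y → ℝ)
    (hc_cont : Continuous (fun q : X × Y => c q.1 q.2))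
    (hcconv : ∀ k : ℕ, TendstoUniformlyOn (fun (n : ℕ) (q : X × Y) => cn n q.1 q.2)
        (fun q : X × Y => c q.1 q.2) atTop
        ((Metric.closedBall x₀ (k : ℝ)) ×ˢ (Metric.closedBall y₀ (k : ℝ))))
    (πn : ℕ → ProbabilityMeasure (X × Y)) (π : ProbabilityMeasure (X × Y))
    (hπ : Tendsto πn atTop (𝓝 π))
    (h : ∀ n, CycMono (cn n) (πn n : Measure (X × Y)).support) :
    CycMono c (π : Measure (X × Y)).support := by
  intro N q σ hq
  refine le_of_forall_pos_le_add fun ε' hε' => ?_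
  obtain ⟨ε, hε, hεε⟩ : ∃ ε : ℝ, 0 < ε ∧ ε + N * ε + N * ε ≤ ε' := by
    refine ⟨ε' / (1 + 2 * N), by positivity, le_of_eq (by field_simp; ring)⟩
  obtain ⟨k, hk⟩ : ∃ k : ℕ, ∀ i, dist (q i) (x₀, y₀) < k := by
    obtain ⟨k, hk⟩ := exists_nat_gt (∑ i, dist (q i) (x₀, y₀))
    refine ⟨k, fun i => lt_of_le_of_lt ?_ hk⟩
    exact Finset.single_le_sum (f := fun i => dist (q i) (x₀, y₀))
      (fun _ _ => dist_nonneg) (Finset.mem_univ i)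
  let F : (Fin N → X × Y) → ℝ := fun p => ∑ i, c (p i).1 (p i).2 - ∑ i, c (p i).1 (p (σ i)).2
  have hF : Continuous F := by
    refine Continuous.sub ?_ ?_
    · refine continuous_finsetSum _ fun i _ => ?_
      exact hc_cont.comp (continuous_apply i)
    · refine continuous_finsetSum _ fun i _ => ?_
      exact hc_cont.comp (f := fun p : Fin N → X × Y => ((p i).1, (p (σ i)).2)) (by fun_prop)
  have e1 : ∀ᶠ p in 𝓝 q, F q - ε < F p := hF.continuousAt.eventually_const_lt (by linarith)
  have e2 : ∀ᶠ p in 𝓝 q, ∀ i, dist (p i) (x₀, y₀) < k := by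
    refine eventually_all.2 fun i => ?_
    have : Continuous (fun p : Fin N → X × Y => dist (p i) (x₀, y₀)) := by fun_prop
    exact this.continuousAt.eventually_lt_const (hk i)
  obtain ⟨r, hr, hball⟩ := Metric.eventually_nhds_iff.1 (e1.and e2)
  have e3 : ∀ᶠ n in atTop, ∀ i, 0 < (πn n : Measure (X × Y)) (Metric.ball (q i) r) := by
    refine eventually_all.2 fun i => ?_
    have h0 := (Measure.mem_support_iff_forall _).1 (hq i) _ (Metric.ball_mem_nhds _ hr)
    exact eventually_lt_of_lt_liminf (h0.trans_le
      (ProbabilityMeasure.le_liminf_measure_open_of_tendsto hπ Metric.isOpen_ball))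
  have e4 := Metric.tendstoUniformlyOn_iff.1 (hcconv k) ε hε
  obtain ⟨n, h3, h4⟩ := (e3.and e4).exists
  have h5 : ∀ i, (Metric.ball (q i) r ∩ (πn n : Measure (X × Y)).support).Nonempty := fun i =>
    Measure.nonempty_inter_support_of_pos (h3 i)
  choose p hp using h5
  obtain ⟨hp1, hp2⟩ := hball (y := p) ((dist_pi_lt_iff hr).2 fun i => (hp i).1)
  have hcm := h n N p σ (fun i => (hp i).2)
  have hb : ∀ i j, |c (p i).1 (p j).2 - cn n (p i).1 (p j).2| < ε := by
    intro i j
    refine h4 ((p i).1, (p j).2) ⟨?_, ?_⟩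
    · exact ((le_max_left _ _).trans_lt (hp2 i)).le
    · exact ((le_max_right _ _).trans_lt (hp2 j)).le
  have s1 : ∑ i, c (p i).1 (p i).2 ≤ ∑ i, cn n (p i).1 (p i).2 + N * ε := by
    calc _ ≤ ∑ i, (cn n (p i).1 (p i).2 + ε) :=
          Finset.sum_le_sum fun i _ => by linarith [(abs_lt.1 (hb i i)).2]
      _ = _ := by simp [Finset.sum_add_distrib]
  have s2 : ∑ i, cn n (p i).1 (p (σ i)).2 ≤ ∑ i, c (p i).1 (p (σ i)).2 + N * ε := by
    calc _ ≤ ∑ i, (c (p i).1 (p (σ i)).2 + ε) :=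
          Finset.sum_le_sum fun i _ => by linarith [(abs_lt.1 (hb i (σ i))).1]
      _ = _ := by simp [Finset.sum_add_distrib]
  simp only [F] at hp1
  linarith

lemma lsc_cost {X Y : Type*}
    [MetricSpace X] [SecondCountableTopology X] [MeasurableSpace X] [BorelSpace X]
    [MetricSpace Y] [SecondCountableTopology Y] [MeasurableSpace Y] [BorelSpace Y]
    (x₀ : X) (y₀ : Y) (m : ℝ≥0∞)
    (cn : ℕ → X → Y → ℝ) (c : X → Y → ℝ)
    (hcn_nonneg : ∀ n x y, 0 ≤ cn n x y)
    (hc_cont : Continuous (fun q : X × Y => c q.1 q.2))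
    (hc_nonneg : ∀ x y, 0 ≤ c x y)
    (hcconv : ∀ k : ℕ, TendstoUniformlyOn (fun (n : ℕ) (q : X × Y) => cn n q.1 q.2)
        (fun q : X × Y => c q.1 q.2) atTop
        ((Metric.closedBall x₀ (k : ℝ)) ×ˢ (Metric.closedBall y₀ (k : ℝ))))
    (πn : ℕ → ProbabilityMeasure (X × Y)) (π : ProbabilityMeasure (X × Y))
    (hπ : Tendsto πn atTop (𝓝 π))
    (h : ∀ n, ∫⁻ q, ENNReal.ofReal (cn n q.1 q.2) ∂(πn n : Measure (X × Y)) ≤ m) :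
    ∫⁻ q, ENNReal.ofReal (c q.1 q.2) ∂(π : Measure (X × Y)) ≤ m := by
  let χ : ℕ → X × Y → ℝ := fun k q => max 0 (min 1 (k - dist q (x₀, y₀)))
  have hχ : ∀ k, Continuous (χ k) := fun k => by fun_prop
  have hχ0 : ∀ k q, 0 ≤ χ k q := fun k q => le_max_left _ _
  have hχ1 : ∀ k q, χ k q ≤ 1 := fun k q => max_le zero_le_one (min_le_left _ _)
  let f : ℕ → X × Y → ℝ := fun k q => c q.1 q.2 * χ k q
  have hf : ∀ k, Continuous (f k) := fun k => hc_cont.mul (hχ k)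
  have hf0 : ∀ k q, 0 ≤ f k q := fun k q => mul_nonneg (hc_nonneg _ _) (hχ0 k q)
  have hk : ∀ k, ∫⁻ q, ENNReal.ofReal (f k q) ∂(π : Measure (X × Y)) ≤ m := by
    intro k
    refine ENNReal.le_of_forall_pos_le_add fun ε hε _ => ?_
    refine (lintegral_le_liminf_lintegral_of_forall_isOpen_measure_le_liminf_measure
      (μs := fun n => (πn n : Measure (X × Y))) (hf k) (hf0 k)
      (fun G hG => ProbabilityMeasure.le_liminf_measure_open_of_tendsto hπ hG)).trans ?_
    refine liminf_le_of_frequently_le' (Eventually.frequently ?_)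
    filter_upwards [Metric.tendstoUniformlyOn_iff.1 (hcconv k) ε hε] with n hn
    calc ∫⁻ q, ENNReal.ofReal (f k q) ∂(πn n : Measure (X × Y))
        ≤ ∫⁻ q, (ENNReal.ofReal (cn n q.1 q.2) + ε) ∂(πn n : Measure (X × Y)) := by
          refine lintegral_mono fun q => ?_
          rw [← ENNReal.ofReal_coe_nnreal (p := ε), ← ENNReal.ofReal_add (hcn_nonneg n q.1 q.2) ε.coe_nonneg]
          refine ENNReal.ofReal_le_ofReal ?_
          by_cases hq : dist q (x₀, y₀) ≤ k
          · have := hn q ⟨(le_max_left _ _).trans hq, (le_max_right _ _).trans hq⟩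
            have h1 : |c q.1 q.2 - cn n q.1 q.2| < ε := this
            have h2 : f k q ≤ c q.1 q.2 := mul_le_of_le_one_right (hc_nonneg _ _) (hχ1 k q)
            linarith [(abs_lt.1 h1).2]
          · have h2 : χ k q = 0 := by
              apply max_eq_left
              exact (min_le_right _ _).trans (by linarith)
            have : f k q = 0 := by simp [f, h2]
            rw [this]
            exact add_nonneg (hcn_nonneg _ _ _) ε.coe_nonneg
      _ = ∫⁻ q, ENNReal.ofReal (cn n q.1 q.2) ∂(πn n : Measure (X × Y)) + ε := by
          rw [lintegral_add_right _ measurable_const]; simp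
      _ ≤ m + ε := by gcongr; exact h n
  calc ∫⁻ q, ENNReal.ofReal (c q.1 q.2) ∂(π : Measure (X × Y))
      = ∫⁻ q, liminf (fun k => ENNReal.ofReal (f k q)) atTop ∂(π : Measure (X × Y)) := by
        refine lintegral_congr fun q => ?_
        have : Tendsto (fun k => ENNReal.ofReal (f k q)) atTop (𝓝 (ENNReal.ofReal (c q.1 q.2))) := by
          refine tendsto_const_nhds.congr' ?_
          obtain ⟨K, hK⟩ := exists_nat_ge (1 + dist q (x₀, y₀))
          filter_upwards [eventually_ge_atTop K] with k hk
          have : (K:ℝ) ≤ k := by exact_mod_cast hk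
          have : χ k q = 1 := by
            simp only [χ]
            rw [min_eq_left (by linarith), max_eq_right zero_le_one]
          simp [f, this]
        exact this.liminf_eq.symm
    _ ≤ liminf (fun k => ∫⁻ q, ENNReal.ofReal (f k q) ∂(π : Measure (X × Y))) atTop :=
        lintegral_liminf_le fun k => (hf k).measurable.ennreal_ofReal
    _ ≤ m := liminf_le_of_frequently_le' (Eventually.frequently (Eventually.of_forall hk))

lemma inf_helper {Z ι : Type*} [TopologicalSpace Z] [MeasurableSpace Z] [BorelSpace Z]
    [Nonempty ι] (V : ι → Z → ℝ) (hV : ∀ s, Continuous (V s)) :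
    ∃ (f : Z → ℝ) (Z' : Set Z), Measurable f ∧ MeasurableSet Z' ∧
      (∀ z ∈ Z', ∀ s, f z ≤ V s z) ∧ (∀ z t, (∀ s, t ≤ V s z) → z ∈ Z' ∧ t ≤ f z) := by
  let φ : Z → EReal := fun z => ⨅ s, ((V s z : ℝ) : EReal)
  have hφ : Measurable φ := by
    have : UpperSemicontinuous φ := by
      refine upperSemicontinuous_iInf fun s => ?_
      exact (continuous_coe_real_ereal.comp (hV s)).upperSemicontinuous
    exact this.measurable
  have htop : ∀ z, φ z ≠ ⊤ := by
    intro z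
    obtain ⟨s⟩ := ‹Nonempty ι›
    exact ((iInf_le _ s).trans_lt (EReal.coe_lt_top _)).ne
  refine ⟨fun z => (φ z).toReal, {z | ⊥ < φ z}, hφ.ereal_toReal,
    measurableSet_lt measurable_const hφ, ?_, ?_⟩
  · intro z hz s
    have : φ z ≤ V s z := iInf_le _ s
    have h2 := EReal.coe_toReal (htop z) (ne_of_gt hz)
    rw [← h2] at this
    exact_mod_cast this
  · intro z t ht
    have h1 : (t : EReal) ≤ φ z := le_iInf fun s => by exact_mod_cast ht s
    have h3 : ⊥ < φ z := (EReal.bot_lt_coe t).trans_le h1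
    refine ⟨h3, ?_⟩
    have h2 := EReal.coe_toReal (htop z) (ne_of_gt h3)
    rw [← h2] at h1
    exact_mod_cast h1

/-- Cost of a chain. -/
noncomputable def chainCost {X Y : Type*} (c : X → Y → ℝ) (N : ℕ) (p : ℕ → X × Y) (x : X) : ℝ :=
  ∑ i ∈ Finset.range N, (c (p (i + 1)).1 (p i).2 - c (p i).1 (p i).2) +
    (c x (p N).2 - c (p N).1 (p N).2)

lemma chainCost_loop {X Y : Type*} (c : X → Y → ℝ) (S : Set (X × Y)) (h : CycMono c S)
    (N : ℕ) (p : ℕ → X × Y) (hp : ∀ i, p i ∈ S) : 0 ≤ chainCost c N p (p 0).1 := by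
  have h1 := h (N + 1) (fun i => p i) (finRotate (N + 1)).symm (fun i => hp i)
  rw [← Equiv.sum_comp (finRotate (N + 1))
    (fun i => c (p i).1 (p ((finRotate (N + 1)).symm i : Fin (N + 1))).2)] at h1
  simp only [Equiv.symm_apply_apply] at h1
  rw [Fin.sum_univ_castSucc, Fin.sum_univ_castSucc] at h1
  simp only [finRotate_last, Fin.val_last, Fin.val_castSucc, Fin.val_zero] at h1
  have h2 : ∀ i : Fin N, ((finRotate (N + 1) i.castSucc : Fin (N + 1)) : ℕ) = i + 1 := by
    intro i
    rw [coe_finRotate_of_ne_last (Fin.castSucc_lt_last i).ne]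
    simp
  simp only [h2] at h1
  rw [Fin.sum_univ_eq_sum_range (fun i => c (p i).1 (p i).2) N,
    Fin.sum_univ_eq_sum_range (fun i => c (p (i + 1)).1 (p i).2) N] at h1
  rw [chainCost, Finset.sum_sub_distrib]
  linarith

lemma chainCost_extend {X Y : Type*} (c : X → Y → ℝ) (S : Set (X × Y))
    (N : ℕ) (p : ℕ → X × Y) (hp : ∀ i, p i ∈ S) (b : X × Y) (hb : b ∈ S) :
    ∃ p' : ℕ → X × Y, (∀ i, p' i ∈ S) ∧ p' 0 = p 0 ∧
      ∀ x, chainCost c (N + 1) p' x = chainCost c N p b.1 + (c x b.2 - c b.1 b.2) := by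
  refine ⟨fun i => if i ≤ N then p i else b, ?_, by simp, ?_⟩
  · intro i
    dsimp only
    split_ifs
    exacts [hp i, hb]
  · intro x
    simp only [chainCost]
    rw [Finset.sum_range_succ]
    have : ∀ i ∈ Finset.range N,
        (c (if i + 1 ≤ N then p (i + 1) else b).1 (if i ≤ N then p i else b).2
          - c (if i ≤ N then p i else b).1 (if i ≤ N then p i else b).2) =
        (c (p (i + 1)).1 (p i).2 - c (p i).1 (p i).2) := by
      intro i hi
      have hi := Finset.mem_range.1 hi
      rw [if_pos (by omega), if_pos (by omega)]
    rw [Finset.sum_congr rfl this]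
    simp

lemma exists_potentials {X Y : Type*}
    [TopologicalSpace X] [MeasurableSpace X] [BorelSpace X]
    [TopologicalSpace Y] [MeasurableSpace Y] [BorelSpace Y]
    (c : X → Y → ℝ) (hc : Continuous (fun q : X × Y => c q.1 q.2))
    (S : Set (X × Y)) (hS : S.Nonempty) (h : CycMono c S) :
    ∃ (f : X → ℝ) (g : Y → ℝ) (X' : Set X) (Y' : Set Y), Measurable f ∧ Measurable g ∧
      MeasurableSet X' ∧ MeasurableSet Y' ∧
      (∀ a ∈ S, a.1 ∈ X' ∧ a.2 ∈ Y' ∧ f a.1 + g a.2 = c a.1 a.2) ∧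
      (∀ x ∈ X', ∀ y ∈ Y', f x + g y ≤ c x y) := by
  obtain ⟨q0, hq0⟩ := hS
  let ι := {s : ℕ × (ℕ → X × Y) // (∀ i, s.2 i ∈ S) ∧ s.2 0 = q0}
  have : Nonempty ι := ⟨⟨(0, fun _ => q0), fun _ => hq0, rfl⟩⟩
  obtain ⟨f, X', hf, hX', hf1, hf2⟩ := inf_helper (fun (s : ι) (x : X) => chainCost c s.1.1 s.1.2 x)
    (by
      intro s
      unfold chainCost
      have : Continuous fun x => c x (s.1.2 s.1.1).2 :=
        hc.comp (f := fun x => (x, (s.1.2 s.1.1).2)) (by fun_prop)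
      fun_prop)
  have hmem : ∀ a ∈ S, a.1 ∈ X' := by
    intro a ha
    refine (hf2 a.1 (c a.1 a.2 - c q0.1 a.2) ?_).1
    rintro ⟨⟨N, p⟩, hp, hp0⟩
    dsimp only at hp hp0 ⊢
    obtain ⟨p', hp', hp0', hext⟩ := chainCost_extend c S N p hp a ha
    have := chainCost_loop c S h (N + 1) p' hp'
    rw [hext, hp0', hp0] at this
    linarith
  have : Nonempty X' := ⟨⟨q0.1, hmem q0 hq0⟩⟩
  obtain ⟨g, Y', hg, hY', hg1, hg2⟩ := inf_helper (fun (x : X') (y : Y) => c x y - f x)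
    (by
      intro x
      have : Continuous fun y => c x y := hc.comp (f := fun y => ((x : X), y)) (by fun_prop)
      fun_prop)
  have hle : ∀ x ∈ X', ∀ y ∈ Y', f x + g y ≤ c x y := by
    intro x hx y hy
    have := hg1 y hy ⟨x, hx⟩
    dsimp only at this
    linarith
  refine ⟨f, g, X', Y', hf, hg, hX', hY', ?_, hle⟩
  intro a ha
  have hax := hmem a ha
  obtain ⟨hay, hge⟩ := hg2 a.2 (c a.1 a.2 - f a.1) (by
    rintro ⟨x, hx⟩
    dsimp only
    have := (hf2 a.1 (f x - c x a.2 + c a.1 a.2) (by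
      rintro ⟨⟨N, p⟩, hp, hp0⟩
      dsimp only at hp hp0 ⊢
      obtain ⟨p', hp', hp0', hext⟩ := chainCost_extend c S N p hp a ha
      have h1 := hf1 x hx ⟨(N + 1, p'), hp', hp0'.trans hp0⟩
      dsimp only at h1
      rw [hext] at h1
      linarith)).2
    linarith)
  refine ⟨hax, hay, le_antisymm (hle _ hax _ hay) (by linarith)⟩

lemma optimal_of_cycMono {X Y : Type*}
    [MetricSpace X] [SecondCountableTopology X] [MeasurableSpace X] [BorelSpace X]
    [MetricSpace Y] [SecondCountableTopology Y] [MeasurableSpace Y] [BorelSpace Y]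
    (c : X → Y → ℝ) (hc : Continuous (fun q : X × Y => c q.1 q.2)) (hc0 : ∀ x y, 0 ≤ c x y)
    (π : Measure (X × Y)) [IsProbabilityMeasure π] (h : CycMono c π.support)
    (hint : ∫⁻ q, ENNReal.ofReal (c q.1 q.2) ∂(π.fst.prod π.snd) < ⊤) :
    ∫⁻ q, ENNReal.ofReal (c q.1 q.2) ∂π = deterCost c π.fst π.snd := by
  refine le_antisymm ?_ (iInf₂_le π ⟨inferInstance, rfl, rfl⟩)
  refine le_iInf₂ fun π' hπ' => ?_
  obtain ⟨hprob, hfst, hsnd⟩ := hπ'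
  obtain ⟨f, g, X', Y', hf, hg, hX', hY', heq, hle⟩ := exists_potentials c hc π.support
    (Measure.nonempty_support (IsProbabilityMeasure.ne_zero π)) h
  have hsupp : ∀ᵐ q ∂π, q ∈ π.support := Measure.support_mem_ae
  have hμX : ∀ᵐ x ∂π.fst, x ∈ X' := by
    refine (ae_map_iff measurable_fst.aemeasurable hX').2 ?_
    filter_upwards [hsupp] with q hq using (heq q hq).1
  have hνY : ∀ᵐ x ∂π.snd, x ∈ Y' := by
    refine (ae_map_iff measurable_snd.aemeasurable hY').2 ?_
    filter_upwards [hsupp] with q hq using (heq q hq).2.1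
  have hprodint : Integrable (fun q : X × Y => c q.1 q.2) (π.fst.prod π.snd) :=
    (lintegral_ofReal_ne_top_iff_integrable hc.aestronglyMeasurable
      (Eventually.of_forall fun q => hc0 _ _)).1 hint.ne
  obtain ⟨y1, hy1, hy1i⟩ := (hνY.and hprodint.prod_left_ae).exists
  obtain ⟨x1, hx1, hx1i⟩ := (hμX.and hprodint.prod_right_ae).exists
  -- positive parts are integrable
  have hfp : Integrable (fun x => max (f x) 0) π.fst := by
    refine Integrable.mono' (hy1i.add (integrable_const |g y1|))
      (hf.max measurable_const).aestronglyMeasurable ?_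
    filter_upwards [hμX] with x hx
    rw [Real.norm_of_nonneg (le_max_right _ _)]
    have h1 := hle x hx y1 hy1
    have h2 := neg_abs_le (g y1)
    have h3 := hc0 x y1
    have h4 := abs_nonneg (g y1)
    simp only [Pi.add_apply]
    exact max_le (by linarith) (by linarith)
  have hgp : Integrable (fun x => max (g x) 0) π.snd := by
    refine Integrable.mono' (hx1i.add (integrable_const |f x1|))
      (hg.max measurable_const).aestronglyMeasurable ?_
    filter_upwards [hνY] with x hx
    rw [Real.norm_of_nonneg (le_max_right _ _)]
    have h1 := hle x1 hx1 x hx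
    have h2 := neg_abs_le (f x1)
    have h3 := hc0 x1 x
    have h4 := abs_nonneg (f x1)
    simp only [Pi.add_apply]
    exact max_le (by linarith) (by linarith)
  have hfp' : Integrable (fun q : X × Y => max (f q.1) 0) π := hfp.comp_measurable measurable_fst
  have hgp' : Integrable (fun q : X × Y => max (g q.2) 0) π := hgp.comp_measurable measurable_snd
  have hbd : ∀ᵐ q ∂π, |f q.1| ≤ max (f q.1) 0 + max (g q.2) 0 ∧
      |g q.2| ≤ max (f q.1) 0 + max (g q.2) 0 := by
    filter_upwards [hsupp] with q hq
    have h1 := (heq q hq).2.2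
    have h2 := hc0 q.1 q.2
    have a1 := le_max_left (f q.1) 0
    have a2 := le_max_right (f q.1) 0
    have a3 := le_max_left (g q.2) 0
    have a4 := le_max_right (g q.2) 0
    exact ⟨abs_le.2 ⟨by linarith, by linarith⟩, abs_le.2 ⟨by linarith, by linarith⟩⟩
  have hfi : Integrable f π.fst := by
    refine (integrable_map_measure hf.aestronglyMeasurable measurable_fst.aemeasurable).2 ?_
    exact Integrable.mono' (hfp'.add hgp') (hf.comp measurable_fst).aestronglyMeasurable
      (hbd.mono fun q hq => hq.1)
  have hgi : Integrable g π.snd := by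
    refine (integrable_map_measure hg.aestronglyMeasurable measurable_snd.aemeasurable).2 ?_
    exact Integrable.mono' (hfp'.add hgp') (hg.comp measurable_snd).aestronglyMeasurable
      (hbd.mono fun q hq => hq.2)
  have hval : ∀ κ : Measure (X × Y), κ.fst = π.fst → κ.snd = π.snd →
      Integrable (fun q : X × Y => f q.1 + g q.2) κ ∧
      ∫ q, (f q.1 + g q.2) ∂κ = ∫ x, f x ∂π.fst + ∫ y, g y ∂π.snd := by
    intro κ h1 h2
    have i1 : Integrable (fun q : X × Y => f q.1) κ := by
      rw [← h1] at hfi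
      exact hfi.comp_measurable measurable_fst
    have i2 : Integrable (fun q : X × Y => g q.2) κ := by
      rw [← h2] at hgi
      exact hgi.comp_measurable measurable_snd
    refine ⟨i1.add i2, ?_⟩
    rw [integral_add i1 i2, ← h1, ← h2, Measure.fst, Measure.snd,
      integral_map measurable_fst.aemeasurable hf.aestronglyMeasurable,
      integral_map measurable_snd.aemeasurable hg.aestronglyMeasurable]
  by_cases hfin : ∫⁻ q, ENNReal.ofReal (c q.1 q.2) ∂π' = ⊤
  · rw [hfin]; exact le_top
  have hci' : Integrable (fun q : X × Y => c q.1 q.2) π' :=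
    (lintegral_ofReal_ne_top_iff_integrable hc.aestronglyMeasurable
      (Eventually.of_forall fun q => hc0 _ _)).1 hfin
  obtain ⟨j1, j2⟩ := hval π rfl rfl
  obtain ⟨j3, j4⟩ := hval π' hfst hsnd
  have haeq : (fun q : X × Y => f q.1 + g q.2) =ᵐ[π] fun q => c q.1 q.2 := by
    filter_upwards [hsupp] with q hq using (heq q hq).2.2
  have hci : Integrable (fun q : X × Y => c q.1 q.2) π := j1.congr haeq
  rw [← ofReal_integral_eq_lintegral_ofReal hci (Eventually.of_forall fun q => hc0 _ _),
    ← ofReal_integral_eq_lintegral_ofReal hci' (Eventually.of_forall fun q => hc0 _ _)]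
  refine ENNReal.ofReal_le_ofReal ?_
  rw [← integral_congr_ae haeq, j2, ← j4]
  refine integral_mono_ae j3 hci' ?_
  have k1 : ∀ᵐ q ∂π', q.1 ∈ X' := by
    rw [← hfst] at hμX
    exact (ae_map_iff measurable_fst.aemeasurable hX').1 hμX
  have k2 : ∀ᵐ q ∂π', q.2 ∈ Y' := by
    rw [← hsnd] at hνY
    exact (ae_map_iff measurable_snd.aemeasurable hY').1 hνY
  filter_upwards [k1, k2] with q h1 h2 using hle _ h1 _ h2

/-- **Closedness of `{(c,μ,ν) ∈ 𝕄_m : Φ(c,μ,ν) ∩ A ≠ ∅}` in `𝕄`.** Since `𝕄` is a metric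
space (sum of uniform convergence on products of closed balls and weak convergence
metrics), closedness is stated sequentially: if `(c_n,μ_n,ν_n) ∈ 𝕄_m`, every
`Φ(c_n,μ_n,ν_n)` meets the closed set `A ⊆ P(X×Y)`, and `(c_n,μ_n,ν_n) → (c,μ,ν) ∈ 𝕄`,
then `(c,μ,ν) ∈ 𝕄_m` and `Φ(c,μ,ν)` meets `A`. -/
theorem optimal_plan_set_closed
    {X Y : Type*}
    [MetricSpace X] [CompleteSpace X] [SecondCountableTopology X]
    [MeasurableSpace X] [BorelSpace X]
    [MetricSpace Y] [CompleteSpace Y] [SecondCountableTopology Y]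
    [MeasurableSpace Y] [BorelSpace Y]
    (x₀ : X) (y₀ : Y) (m : ℕ)
    (A : Set (ProbabilityMeasure (X × Y))) (hA : IsClosed A)
    (cn : ℕ → X → Y → ℝ) (c : X → Y → ℝ)
    (hcn_cont : ∀ n, Continuous (fun q : X × Y => cn n q.1 q.2))
    (hcn_nonneg : ∀ n x y, 0 ≤ cn n x y)
    (hc_cont : Continuous (fun q : X × Y => c q.1 q.2))
    (hc_nonneg : ∀ x y, 0 ≤ c x y)
    (μn : ℕ → ProbabilityMeasure X) (μ : ProbabilityMeasure X)
    (νn : ℕ → ProbabilityMeasure Y) (ν : ProbabilityMeasure Y)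
    -- `(c_n, μ_n, ν_n) ∈ 𝕄_m`
    (hMm : ∀ n, ∫⁻ q, ENNReal.ofReal (cn n q.1 q.2)
        ∂((μn n : Measure X).prod (νn n : Measure Y)) ≤ (m : ℝ≥0∞))
    -- `Φ(c_n, μ_n, ν_n) ∩ A ≠ ∅`
    (hΦA : ∀ n, ∃ π : ProbabilityMeasure (X × Y), π ∈ A ∧
        (π : Measure (X × Y)).fst = (μn n : Measure X) ∧
        (π : Measure (X × Y)).snd = (νn n : Measure Y) ∧
        ∫⁻ q, ENNReal.ofReal (cn n q.1 q.2) ∂(π : Measure (X × Y)) =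
          deterCost (cn n) (μn n : Measure X) (νn n : Measure Y))
    -- convergence `(c_n, μ_n, ν_n) → (c, μ, ν)` in `𝕄`
    (hcconv : ∀ k : ℕ, TendstoUniformlyOn (fun (n : ℕ) (q : X × Y) => cn n q.1 q.2)
        (fun q : X × Y => c q.1 q.2) atTop
        ((Metric.closedBall x₀ (k : ℝ)) ×ˢ (Metric.closedBall y₀ (k : ℝ))))
    (hμ : Tendsto μn atTop (𝓝 μ)) (hν : Tendsto νn atTop (𝓝 ν))
    -- the limit lies in `𝕄`
    (hint : ∫⁻ q, ENNReal.ofReal (c q.1 q.2)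
        ∂((μ : Measure X).prod (ν : Measure Y)) < ⊤) :
    (∫⁻ q, ENNReal.ofReal (c q.1 q.2)
        ∂((μ : Measure X).prod (ν : Measure Y)) ≤ (m : ℝ≥0∞)) ∧
    ∃ π : ProbabilityMeasure (X × Y), π ∈ A ∧
      (π : Measure (X × Y)).fst = (μ : Measure X) ∧
      (π : Measure (X × Y)).snd = (ν : Measure Y) ∧
      ∫⁻ q, ENNReal.ofReal (c q.1 q.2) ∂(π : Measure (X × Y)) =
        deterCost c (μ : Measure X) (ν : Measure Y) := by
  have hprodconv : Tendsto (fun n => (μn n).prod (νn n)) atTop (𝓝 (μ.prod ν)) :=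
    (ProbabilityMeasure.continuous_prod.tendsto (μ, ν)).comp (hμ.prodMk_nhds hν)
  refine ⟨lsc_cost x₀ y₀ m cn c hcn_nonneg hc_cont hc_nonneg hcconv
    (fun n => (μn n).prod (νn n)) (μ.prod ν) hprodconv hMm, ?_⟩
  choose πn hπA hπfst hπsnd hπopt using hΦA
  have tμ : IsTightMeasureSet
      {((μ : ProbabilityMeasure X) : Measure X) | μ ∈ Set.range μn} :=
    isTightMeasureSet_of_isCompact_closure
      (hμ.isCompact_insert_range.closure_of_subset (Set.subset_insert _ _))
  have tν : IsTightMeasureSet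
      {((μ : ProbabilityMeasure Y) : Measure Y) | μ ∈ Set.range νn} :=
    isTightMeasureSet_of_isCompact_closure
      (hν.isCompact_insert_range.closure_of_subset (Set.subset_insert _ _))
  have tπ : IsTightMeasureSet
      {((μ : ProbabilityMeasure (X × Y)) : Measure (X × Y)) | μ ∈ Set.range πn} := by
    refine IsTightMeasureSet.prodMk (tμ.subset ?_) (tν.subset ?_)
    · rintro _ ⟨_, ⟨_, ⟨n, rfl⟩, rfl⟩, rfl⟩
      exact ⟨μn n, ⟨n, rfl⟩, (hπfst n).symm⟩
    · rintro _ ⟨_, ⟨_, ⟨n, rfl⟩, rfl⟩, rfl⟩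
      exact ⟨νn n, ⟨n, rfl⟩, (hπsnd n).symm⟩
  obtain ⟨π, -, s, hs, hπ⟩ := (isCompact_closure_of_isTightMeasureSet tπ).isSeqCompact
    (fun n => subset_closure (Set.mem_range_self (f := πn) n))
  have hfst : (π : Measure (X × Y)).fst = (μ : Measure X) := by
    have h1 : Tendsto (fun n => (πn (s n)).map measurable_fst.aemeasurable) atTop
        (𝓝 (π.map measurable_fst.aemeasurable)) :=
      ProbabilityMeasure.tendsto_map_of_tendsto_of_continuous _ _ hπ continuous_fst
    have h2 : (fun n => (πn (s n)).map measurable_fst.aemeasurable) = fun n => μn (s n) := by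
      funext n
      exact Subtype.ext (hπfst (s n))
    rw [h2] at h1
    have h3 := tendsto_nhds_unique h1 (hμ.comp hs.tendsto_atTop)
    exact congrArg (fun κ : ProbabilityMeasure X => (κ : Measure X)) h3
  have hsnd : (π : Measure (X × Y)).snd = (ν : Measure Y) := by
    have h1 : Tendsto (fun n => (πn (s n)).map measurable_snd.aemeasurable) atTop
        (𝓝 (π.map measurable_snd.aemeasurable)) :=
      ProbabilityMeasure.tendsto_map_of_tendsto_of_continuous _ _ hπ continuous_snd
    have h2 : (fun n => (πn (s n)).map measurable_snd.aemeasurable) = fun n => νn (s n) := by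
      funext n
      exact Subtype.ext (hπsnd (s n))
    rw [h2] at h1
    have h3 := tendsto_nhds_unique h1 (hν.comp hs.tendsto_atTop)
    exact congrArg (fun κ : ProbabilityMeasure Y => (κ : Measure Y)) h3
  refine ⟨π, hA.mem_of_tendsto hπ (Eventually.of_forall fun n => hπA _), hfst, hsnd, ?_⟩
  have hcm : CycMono c (π : Measure (X × Y)).support := by
    refine cycMono_limit x₀ y₀ (fun n => cn (s n)) c hc_cont ?_ (fun n => πn (s n)) π hπ ?_
    · intro k u hu
      exact hs.tendsto_atTop.eventually (hcconv k u hu)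
    · intro n
      refine cycMono_of_optimal (cn (s n)) (hcn_cont _) (hcn_nonneg _) _ ?_ ?_
      · rw [hπfst, hπsnd]; exact hπopt _
      · rw [hπopt]
        refine ne_top_of_le_ne_top (ENNReal.natCast_ne_top m) (le_trans ?_ (hMm (s n)))
        exact iInf₂_le ((μn (s n) : Measure X).prod (νn (s n) : Measure Y))
          ⟨inferInstance, Measure.fst_prod, Measure.snd_prod⟩
  rw [← hfst, ← hsnd]
  refine optimal_of_cycMono c hc_cont hc_nonneg π hcm ?_
  rw [hfst, hsnd]
  exact hint
end
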